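/- arXiv:1106.5672 — 9 statements merged into one kernel-verified Lean document; each statement's English description precedes it below -/
import Mathlib

section
/- Let ‖·‖ be a seminorm on ℝⁿ, let F, G : ℝⁿ → ℝⁿ, and let τ, τ̃ > 0 satisfy ‖y + h·F(y)‖ ≤ ‖y‖ for all y ∈ ℝⁿ and all h ∈ [0, τ], and ‖y + h·G(y)‖ ≤ ‖y‖ for all y ∈ ℝⁿ and all h ∈ [0, τ̃]. Let (A, b) and (Ã, b̃) be the coefficients of an s-stage additive Runge–Kutta method that is absolutely monotonic at the point (−r, −r̃) with r, r̃ > 0. Then for every step size Δt with 0 < Δt ≤ min{r·τ, r̃·τ̃}, every y_old ∈ ℝⁿ, and every collection of stage vectors y₁, …, y_s ∈ ℝⁿ satisfying y_i = y_old + Δt·Σ_{j=1}^{s} a_{ij} F(y_j) + Δt·Σ_{j=1}^{s} ã_{ij} G(y_j) for i = 1, …, s, one has ‖y_i‖ ≤ ‖y_old‖ for all i = 1, …, s, and ‖y_new‖ ≤ ‖y_old‖ where y_new = y_old + Δt·Σ_{j=1}^{s} b_j F(y_j) + Δt·Σ_{j=1}^{s} b̃_j G(y_j). -/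
open Matrix Set

noncomputable section

/-- Augmented (s+1)×(s+1) matrix `[[A, 0], [bᵀ, 0]]` of an s-stage Runge–Kutta scheme. -/
def rkAugment {s : ℕ} (A : Matrix (Fin s) (Fin s) ℝ) (b : Fin s → ℝ) :
    Matrix (Fin (s + 1)) (Fin (s + 1)) ℝ := fun i j =>
  if hj : (j : ℕ) < s then
    if hi : (i : ℕ) < s then A ⟨i, hi⟩ ⟨j, hj⟩ else b ⟨j, hj⟩
  else 0

/-- Absolute monotonicity of the additive pair `(A, At)` (weights `b`, `bt`)
at the point `(-r, -rt)`. -/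
def absMonoPairAt {s : ℕ} (A At : Matrix (Fin s) (Fin s) ℝ) (b bt : Fin s → ℝ)
    (r rt : ℝ) : Prop :=
  let K := rkAugment A b
  let Kt := rkAugment At bt
  let M := (1 : Matrix (Fin (s + 1)) (Fin (s + 1)) ℝ) + r • K + rt • Kt
  IsUnit M ∧ (∀ i j, 0 ≤ (M⁻¹ * K) i j) ∧ (∀ i j, 0 ≤ (M⁻¹ * Kt) i j) ∧
    (∀ i, 0 ≤ M⁻¹.mulVec (fun _ => 1) i)

/-- A nonnegative matrix with row sums at most one and without nonzero fixed vectors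
admits no subsolution `w ≤ N *ᵥ w` with a positive entry. -/
theorem nonpos_of_le_mulVec {m : Type*} [Fintype m] {N : Matrix m m ℝ}
    (hN : ∀ i j, 0 ≤ N i j) (hsum : ∀ i, ∑ j, N i j ≤ 1)
    (hfix : ∀ u : m → ℝ, N *ᵥ u = u → u = 0)
    {w : m → ℝ} (hw : w ≤ N *ᵥ w) : w ≤ 0 := by
  have hmono : ∀ {x z : m → ℝ}, x ≤ z → N *ᵥ x ≤ N *ᵥ z := fun {x z} h i =>
    Finset.sum_le_sum fun j _ => mul_le_mul_of_nonneg_left (h j) (hN i j)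
  set c : m → ℝ := fun _ => ∑ j, |w j|
  have hwc : w ≤ c := fun i =>
    (le_abs_self _).trans
      (Finset.single_le_sum (f := fun j => |w j|) (fun j _ => abs_nonneg _) (Finset.mem_univ i))
  have hNc : N *ᵥ c ≤ c := fun i => by
    simp only [Matrix.mulVec, dotProduct, c, ← Finset.sum_mul]
    exact mul_le_of_le_one_left (Finset.sum_nonneg fun j _ => abs_nonneg _) (hsum i)
  set S : Set (m → ℝ) := {x | x ≤ N *ᵥ x ∧ x ≤ c}
  have hlub : IsLUB S (sSup S) := isLUB_csSup ⟨w, hw, hwc⟩ ⟨c, fun x hx => hx.2⟩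
  have hle : sSup S ≤ N *ᵥ sSup S := hlub.2 fun x hx => hx.1.trans (hmono (hlub.1 hx))
  have hge : N *ᵥ sSup S ≤ sSup S :=
    hlub.1 ⟨hmono hle, (hmono (hlub.2 fun x hx => hx.2)).trans hNc⟩
  exact (hlub.1 ⟨hw, hwc⟩).trans (hfix _ (hge.antisymm hle)).le

theorem rkAugment_castSucc_castSucc {s : ℕ} (A : Matrix (Fin s) (Fin s) ℝ) (b : Fin s → ℝ)
    (i j : Fin s) : rkAugment A b i.castSucc j.castSucc = A i j := by
  simp [rkAugment]

theorem rkAugment_last_castSucc {s : ℕ} (A : Matrix (Fin s) (Fin s) ℝ) (b : Fin s → ℝ)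
    (j : Fin s) : rkAugment A b (Fin.last s) j.castSucc = b j := by
  simp [rkAugment]

theorem rkAugment_last {s : ℕ} (A : Matrix (Fin s) (Fin s) ℝ) (b : Fin s → ℝ)
    (i : Fin (s + 1)) : rkAugment A b i (Fin.last s) = 0 := by
  simp [rkAugment]

/-- A seminorm of a nonnegative combination is bounded by the same combination of bounds. -/
theorem Seminorm.sum_smul_le {E ι : Type*} [AddCommGroup E] [Module ℝ E] [Fintype ι]
    (p : Seminorm ℝ E) {a : ι → ℝ} (ha : ∀ j, 0 ≤ a j) {x : ι → E} {v : ι → ℝ}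
    (hx : ∀ j, p (x j) ≤ v j) : p (∑ j, a j • x j) ≤ ∑ j, a j * v j := by
  refine (Finset.le_sum_of_subadditive p (map_zero p).le (map_add_le_add p) _ _).trans
    (Finset.sum_le_sum fun j _ => ?_)
  rw [map_smul_eq_mul, Real.norm_of_nonneg (ha j)]
  exact mul_le_mul_of_nonneg_left (hx j) (ha j)

theorem Matrix.mul_apply_eq_sum_smul {l m k : Type*} [Fintype m] (B : Matrix l m ℝ)
    (X : Matrix m k ℝ) (i : l) : (B * X) i = ∑ j, B i j • X j := by
  ext q
  simp [Matrix.mul_apply]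

/-- Shu–Osher form of the additive scheme `Y = E + d K Φ + d Kt Γ`. -/
theorem shuOsher_form {m k : Type*} [Fintype m] [DecidableEq m] {K Kt M : Matrix m m ℝ}
    {r rt d : ℝ} (hr : r ≠ 0) (hrt : rt ≠ 0) (hM : M = 1 + r • K + rt • Kt) (hu : IsUnit M)
    {Y E Φ Γ : Matrix m k ℝ} (hY : Y = E + d • (K * Φ) + d • (Kt * Γ)) :
    Y = M⁻¹ * E + r • (M⁻¹ * K * (Y + (d / r) • Φ)) + rt • (M⁻¹ * Kt * (Y + (d / rt) • Γ)) := by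
  have hMY : M * Y = E + r • (K * (Y + (d / r) • Φ)) + rt • (Kt * (Y + (d / rt) • Γ)) := by
    simp only [hM, Matrix.add_mul, Matrix.one_mul, Matrix.mul_add, Matrix.smul_mul,
      Matrix.mul_smul, smul_add, smul_smul, mul_div_cancel₀ _ hr, mul_div_cancel₀ _ hrt]
    nth_rewrite 1 [hY]
    abel
  have h := congrArg (M⁻¹ * ·) hMY
  simp only [← Matrix.mul_assoc, Matrix.nonsing_inv_mul M ((Matrix.isUnit_iff_isUnit_det M).1 hu),
    Matrix.one_mul] at h
  simpa only [Matrix.mul_add, Matrix.mul_smul, Matrix.mul_assoc] using h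

/-- **Monotonicity of additive Runge–Kutta methods** (Higueras):
if the explicit Euler steps for `F` and `G` are seminorm-diminishing with step-size
coefficients `τ`, `τt`, and the additive pair `(A, At)` is absolutely monotonic at
`(-r, -rt)` with `r, rt > 0`, then any step of size `Δt ≤ min (r·τ) (rt·τt)`
diminishes the seminorm of all stages and of the update. -/
theorem imex_ssp_monotonicity
    {n s : ℕ} (p : Seminorm ℝ (Fin n → ℝ)) (F G : (Fin n → ℝ) → (Fin n → ℝ))
    (τ τt : ℝ) (hτ : 0 < τ) (hτt : 0 < τt)
    (hF : ∀ y : Fin n → ℝ, ∀ h ∈ Icc (0 : ℝ) τ, p (y + h • F y) ≤ p y)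
    (hG : ∀ y : Fin n → ℝ, ∀ h ∈ Icc (0 : ℝ) τt, p (y + h • G y) ≤ p y)
    (A At : Matrix (Fin s) (Fin s) ℝ) (b bt : Fin s → ℝ)
    (r rt : ℝ) (hr : 0 < r) (hrt : 0 < rt)
    (ham : absMonoPairAt A At b bt r rt)
    (Δt : ℝ) (hΔ0 : 0 < Δt) (hΔ : Δt ≤ min (r * τ) (rt * τt))
    (yold : Fin n → ℝ) (y : Fin s → (Fin n → ℝ))
    (hstage : ∀ i, y i =
      yold + Δt • ∑ j, A i j • F (y j) + Δt • ∑ j, At i j • G (y j))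
    (ynew : Fin n → ℝ)
    (hnew : ynew = yold + Δt • ∑ j, b j • F (y j) + Δt • ∑ j, bt j • G (y j)) :
    (∀ i, p (y i) ≤ p yold) ∧ p ynew ≤ p yold := by
  obtain ⟨hu, hP, hQ, hγ⟩ := ham
  set K := rkAugment A b
  set Kt := rkAugment At bt
  set M : Matrix (Fin (s + 1)) (Fin (s + 1)) ℝ := 1 + r • K + rt • Kt with hM
  have hdet : IsUnit M.det := (Matrix.isUnit_iff_isUnit_det M).1 hu
  set Y : Matrix (Fin (s + 1)) (Fin n) ℝ := Fin.snoc (α := fun _ => Fin n → ℝ) y ynew with hYdef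
  have hYc : ∀ i : Fin s, Y i.castSucc = y i := fun i => by simp [hYdef]
  have hYl : Y (Fin.last s) = ynew := by simp [hYdef]
  set Φ : Matrix (Fin (s + 1)) (Fin n) ℝ := fun j => F (Y j)
  set Γ : Matrix (Fin (s + 1)) (Fin n) ℝ := fun j => G (Y j)
  set E : Matrix (Fin (s + 1)) (Fin n) ℝ := fun _ => yold
  have hY : Y = E + Δt • (K * Φ) + Δt • (Kt * Γ) := by
    funext i
    change Y i = yold + Δt • (K * Φ) i + Δt • (Kt * Γ) i
    rw [Matrix.mul_apply_eq_sum_smul, Matrix.mul_apply_eq_sum_smul, Fin.sum_univ_castSucc,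
      Fin.sum_univ_castSucc]
    induction i using Fin.lastCases with
    | last =>
      simp only [K, Kt, Φ, Γ, rkAugment_last_castSucc, rkAugment_last, hYc, hYl, zero_smul,
        add_zero]
      exact hnew
    | cast i =>
      simp only [K, Kt, Φ, Γ, rkAugment_castSucc_castSucc, rkAugment_last, hYc, zero_smul,
        add_zero]
      exact hstage i
  have hSO := shuOsher_form hr.ne' hrt.ne' hM hu hY
  set N : Matrix (Fin (s + 1)) (Fin (s + 1)) ℝ := r • (M⁻¹ * K) + rt • (M⁻¹ * Kt) with hN
  have hMN : M⁻¹ + N = 1 := by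
    rw [← Matrix.nonsing_inv_mul M hdet]
    nth_rewrite 3 [hM]
    simp only [hN, Matrix.mul_add, Matrix.mul_smul, Matrix.mul_one, add_assoc]
  have hMNvec : ∀ u, M⁻¹ *ᵥ u + N *ᵥ u = u := fun u => by
    rw [← Matrix.add_mulVec, hMN, Matrix.one_mulVec]
  have hFY : ∀ j, p ((Y + (Δt / r) • Φ) j) ≤ p (Y j) := fun j =>
    hF (Y j) _ ⟨by positivity, (div_le_iff₀' hr).2 (hΔ.trans (min_le_left _ _))⟩
  have hGY : ∀ j, p ((Y + (Δt / rt) • Γ) j) ≤ p (Y j) := fun j =>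
    hG (Y j) _ ⟨by positivity, (div_le_iff₀' hrt).2 (hΔ.trans (min_le_right _ _))⟩
  have hone : ∀ i, (M⁻¹ *ᵥ fun _ => 1) i + ∑ j, N i j = 1 := fun i => by
    simpa [Matrix.mulVec, dotProduct] using congrFun (hMNvec fun _ => 1) i
  have hbound : ∀ i, p (Y i) ≤ (M⁻¹ *ᵥ fun _ => 1) i * p yold + ∑ j, N i j * p (Y j) := by
    intro i
    have hi : Y i = (M⁻¹ *ᵥ fun _ => 1) i • yold
        + r • ∑ j, (M⁻¹ * K) i j • (Y + (Δt / r) • Φ) j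
        + rt • ∑ j, (M⁻¹ * Kt) i j • (Y + (Δt / rt) • Γ) j := by
      rw [← Matrix.mul_apply_eq_sum_smul, ← Matrix.mul_apply_eq_sum_smul]
      have hE : (M⁻¹ *ᵥ fun _ => 1) i • yold = (M⁻¹ * E) i := by
        rw [Matrix.mul_apply_eq_sum_smul]
        simp [Matrix.mulVec, dotProduct, E, Finset.sum_smul]
      rw [hE]
      exact congrFun hSO i
    have hsplit : ∑ j, N i j * p (Y j)
        = r * ∑ j, (M⁻¹ * K) i j * p (Y j) + rt * ∑ j, (M⁻¹ * Kt) i j * p (Y j) := by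
      simp only [hN, Matrix.add_apply, Matrix.smul_apply, smul_eq_mul, add_mul,
        Finset.sum_add_distrib, Finset.mul_sum, mul_assoc]
    rw [hsplit, ← add_assoc, congrArg p hi]
    refine (map_add_le_add p _ _).trans (add_le_add ((map_add_le_add p _ _).trans
      (add_le_add ?_ ?_)) ?_)
    · rw [map_smul_eq_mul, Real.norm_of_nonneg (hγ i)]
    · rw [map_smul_eq_mul, Real.norm_of_nonneg hr.le]
      exact mul_le_mul_of_nonneg_left (p.sum_smul_le (hP i) hFY) hr.le
    · rw [map_smul_eq_mul, Real.norm_of_nonneg hrt.le]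
      exact mul_le_mul_of_nonneg_left (p.sum_smul_le (hQ i) hGY) hrt.le
  have hmain : (fun i => p (Y i) - p yold) ≤ 0 := by
    refine nonpos_of_le_mulVec (N := N) (fun i j => ?_) (fun i => ?_) (fun u hfix => ?_)
      (fun i => ?_)
    · exact add_nonneg (mul_nonneg hr.le (hP i j)) (mul_nonneg hrt.le (hQ i j))
    · linarith [hone i, hγ i]
    · have h0 : M⁻¹ *ᵥ u = 0 := by simpa [hfix] using hMNvec u
      rw [← Matrix.one_mulVec u, ← Matrix.mul_nonsing_inv M hdet, ← Matrix.mulVec_mulVec, h0,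
        Matrix.mulVec_zero]
    · simp only [Matrix.mulVec, dotProduct, mul_sub, Finset.sum_sub_distrib, ← Finset.sum_mul]
      have h1 := hbound i
      rw [eq_sub_of_add_eq (hone i)] at h1
      linarith
  exact ⟨fun i => by simpa [hYc] using hmain i.castSucc,
    by simpa [hYl] using hmain (Fin.last s)⟩
end
end

section
/- For the IMEX pair (A, Ã) of the method SSP2(2,2,2), the region of absolute monotonicity is exactly ℛ(A, Ã) = {(r, r̃) : 0 ≤ r ≤ 1 and 0 ≤ r̃ ≤ √2·(1 − r)}. -/
open Matrix Set

noncomputable section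

/-- The region of absolute monotonicity of the additive pair `(A, At)`:
pairs `(r, rt)` of nonnegative numbers such that the pair is absolutely
monotonic at every point of `[-r, 0] × [-rt, 0]`. -/
def amRegion {s : ℕ} (A At : Matrix (Fin s) (Fin s) ℝ) (b bt : Fin s → ℝ) :
    Set (ℝ × ℝ) :=
  {p | 0 ≤ p.1 ∧ 0 ≤ p.2 ∧
    ∀ r ∈ Icc (0 : ℝ) p.1, ∀ rt ∈ Icc (0 : ℝ) p.2, absMonoPairAt A At b bt r rt}

/-- The matrix `I + x K + y K̃` of the SSP2(2,2,2) pair with general diagonal entry `g`. -/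
theorem one_add_smul_rkAugment_ssp222 (g x y : ℝ) :
    (1 : Matrix (Fin (2 + 1)) (Fin (2 + 1)) ℝ) + x • rkAugment !![(0 : ℝ), 0; 1, 0] ![1 / 2, 1 / 2]
      + y • rkAugment !![g, 0; 1 - 2 * g, g] ![1 / 2, 1 / 2] =
    !![1 + g * y, 0, 0;
       x + (1 - 2 * g) * y, 1 + g * y, 0;
       (x + y) / 2, (x + y) / 2, 1] := by
  ext i j
  fin_cases i <;> fin_cases j <;> simp [rkAugment] <;> ring

/-- Inverse of a lower triangular matrix with diagonal `(d, d, 1)` and constant last row. -/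
theorem lowerTriangular_mul_inverse {d : ℝ} (hd : d ≠ 0) (c h : ℝ) :
    (!![d, 0, 0; c, d, 0; h, h, 1] : Matrix (Fin (2 + 1)) (Fin (2 + 1)) ℝ) *
      !![1 / d, 0, 0; -c / d ^ 2, 1 / d, 0; h * c / d ^ 2 - h / d, -h / d, 1] = 1 := by
  ext i j
  fin_cases i <;> fin_cases j <;>
    simp [Matrix.mul_apply, Fin.sum_univ_three] <;> field_simp <;> ring

/-- For `0 ≤ g ≤ 1/3`, the SSP2(2,2,2) pair with diagonal entry `g` is absolutely monotonic at
`(-x, -y)` exactly when `x + (1 - g) y ≤ 1`. -/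
theorem absMonoPairAt_ssp222_iff {g x y : ℝ} (hg : 0 ≤ g) (hg' : g ≤ 1 / 3)
    (hx : 0 ≤ x) (hy : 0 ≤ y) :
    absMonoPairAt !![(0 : ℝ), 0; 1, 0] !![g, 0; 1 - 2 * g, g] ![1 / 2, 1 / 2] ![1 / 2, 1 / 2]
      x y ↔ x + (1 - g) * y ≤ 1 := by
  obtain ⟨d, hd⟩ : ∃ d, d = 1 + g * y := ⟨_, rfl⟩
  obtain ⟨c, hc⟩ : ∃ c, c = x + (1 - 2 * g) * y := ⟨_, rfl⟩
  obtain ⟨h, hh⟩ : ∃ h, h = (x + y) / 2 := ⟨_, rfl⟩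
  have hgy : 0 ≤ g * y := mul_nonneg hg hy
  have hd0 : 0 < d := by linarith
  have hc0 : 0 ≤ c := by rw [hc]; nlinarith
  have hh0 : 0 ≤ h := by linarith
  have hmul := lowerTriangular_mul_inverse hd0.ne' c h
  unfold absMonoPairAt
  simp only [one_add_smul_rkAugment_ssp222, ← hd, ← hc, ← hh, Matrix.inv_eq_right_inv hmul]
  have hiff : x + (1 - g) * y ≤ 1 ↔ 2 * h ≤ d := by
    rw [hd, hh]; constructor <;> intro _ <;> linarith
  rw [hiff]
  constructor
  · rintro ⟨-, hK, -, -⟩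
    have h20 := hK 2 0
    simp [Matrix.mul_apply, Fin.sum_univ_three, rkAugment] at h20
    have hhd : h / d ≤ 1 / 2 := by
      rw [neg_div] at h20
      linarith
    rw [div_le_iff₀ hd0] at hhd
    linarith
  · intro hle
    have hhd : h / d ≤ 1 / 2 := by rw [div_le_iff₀ hd0]; linarith
    have hhd0 : 0 ≤ h / d := by positivity
    have hq : 0 ≤ h * c / d ^ 2 := by positivity
    have hi : 0 ≤ d⁻¹ := by positivity
    have hcd : c / d ^ 2 ≤ d⁻¹ := by
      rw [div_le_iff₀ (by positivity)]
      have : d⁻¹ * d ^ 2 = d := by field_simp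
      rw [this]
      linarith
    have hgc : c / d ^ 2 * g ≤ d⁻¹ * (1 - 2 * g) := by
      nlinarith
    refine ⟨IsUnit.of_mul_eq_one _ hmul, ?_, ?_, ?_⟩
    · intro i j
      fin_cases i <;> fin_cases j <;>
        simp [Matrix.mul_apply, Fin.sum_univ_three, rkAugment, neg_div, hi]
      linarith
    · intro i j
      fin_cases i <;> fin_cases j <;>
        simp [Matrix.mul_apply, Fin.sum_univ_three, rkAugment, neg_div] <;>
        first | positivity | nlinarith
    · intro i
      fin_cases i <;> simp [Matrix.mulVec, dotProduct, Fin.sum_univ_three, neg_div, hi] <;>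
        linarith

/-- The region of absolute monotonicity of the IMEX SSP2(2,2,2) method
(explicit part `A = [[0,0],[1,0]]`, `b = (1/2,1/2)`; implicit part
`Ã = [[γ,0],[1−2γ,γ]]`, `b̃ = (1/2,1/2)` with `γ = 1 − 1/√2`) is exactly
`{(r, r̃) : 0 ≤ r ≤ 1, 0 ≤ r̃ ≤ √2·(1 − r)}`. -/
theorem ssp222_amRegion :
    amRegion !![(0 : ℝ), 0; 1, 0]
      !![1 - 1 / Real.sqrt 2, 0; 1 - 2 * (1 - 1 / Real.sqrt 2), 1 - 1 / Real.sqrt 2]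
      ![1 / 2, 1 / 2] ![1 / 2, 1 / 2] =
    {p : ℝ × ℝ | 0 ≤ p.1 ∧ p.1 ≤ 1 ∧ 0 ≤ p.2 ∧ p.2 ≤ Real.sqrt 2 * (1 - p.1)} := by
  have hs0 : 0 < Real.sqrt 2 := by positivity
  have hs : Real.sqrt 2 * Real.sqrt 2 = 2 := Real.mul_self_sqrt (by norm_num)
  have hinv : 1 / Real.sqrt 2 = Real.sqrt 2 / 2 := by field_simp; linarith
  have hg : 0 ≤ 1 - 1 / Real.sqrt 2 := by rw [hinv]; nlinarith
  have hg' : 1 - 1 / Real.sqrt 2 ≤ 1 / 3 := by rw [hinv]; nlinarith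
  have hiff (x y : ℝ) :
      x + (1 - (1 - 1 / Real.sqrt 2)) * y ≤ 1 ↔ y ≤ Real.sqrt 2 * (1 - x) := by
    rw [hinv]
    have hsy : Real.sqrt 2 * (Real.sqrt 2 * y) = 2 * y := by rw [← mul_assoc, hs]
    have hsx : Real.sqrt 2 * (Real.sqrt 2 * (1 - x)) = 2 * (1 - x) := by rw [← mul_assoc, hs]
    constructor <;> intro hxy <;> linarith [mul_le_mul_of_nonneg_left hxy hs0.le]
  ext ⟨x, y⟩
  simp only [amRegion, Set.mem_ofPred_eq, Set.mem_Icc]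
  constructor
  · rintro ⟨hx, hy, hall⟩
    have hxy := (hiff x y).1
      ((absMonoPairAt_ssp222_iff hg hg' hx hy).1 (hall x ⟨hx, le_rfl⟩ y ⟨hy, le_rfl⟩))
    exact ⟨hx, by nlinarith, hy, hxy⟩
  · rintro ⟨hx, -, hy, hxy⟩
    refine ⟨hx, hy, fun r hr t ht => ?_⟩
    rw [absMonoPairAt_ssp222_iff hg hg' hr.1 ht.1, hiff]
    nlinarith [mul_le_mul_of_nonneg_left hr.2 hs0.le, hr.2, ht.2]
end
end

section
/- For the method SSP2(2,2,2), the radius of absolute monotonicity of the explicit scheme (A, b) equals 1, and the radius of absolute monotonicity of the implicit scheme (Ã, b̃) equals 1 + √2. -/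
open Matrix Set

noncomputable section

/-- Absolute monotonicity of the scheme `(A, b)` at the point `-r`. -/
def absMonoAt {s : ℕ} (A : Matrix (Fin s) (Fin s) ℝ) (b : Fin s → ℝ) (r : ℝ) : Prop :=
  let K := rkAugment A b
  let M := (1 : Matrix (Fin (s + 1)) (Fin (s + 1)) ℝ) + r • K
  IsUnit M ∧ (∀ i j, 0 ≤ (M⁻¹ * K) i j) ∧ (∀ i, 0 ≤ M⁻¹.mulVec (fun _ => 1) i)

/-- The radius of absolute monotonicity of the scheme `(A, b)`. -/
def amRadius {s : ℕ} (A : Matrix (Fin s) (Fin s) ℝ) (b : Fin s → ℝ) : ℝ :=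
  sSup {r : ℝ | 0 ≤ r ∧ ∀ r' ∈ Icc (0 : ℝ) r, absMonoAt A b r'}

/-- If absolute monotonicity at `-r` amounts to `r ≤ R` for `r ≥ 0`, the radius is `R`. -/
theorem amRadius_eq_of_absMonoAt_iff {s : ℕ} {A : Matrix (Fin s) (Fin s) ℝ} {b : Fin s → ℝ}
    {R : ℝ} (hR : 0 ≤ R) (h : ∀ r, 0 ≤ r → (absMonoAt A b r ↔ r ≤ R)) :
    amRadius A b = R := by
  have hset : {r : ℝ | 0 ≤ r ∧ ∀ r' ∈ Icc (0 : ℝ) r, absMonoAt A b r'} = Icc 0 R := by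
    ext r
    constructor
    · rintro ⟨hr, hmono⟩
      exact ⟨hr, (h r hr).1 (hmono r ⟨hr, le_rfl⟩)⟩
    · rintro ⟨hr, hrR⟩
      exact ⟨hr, fun r' hr' => (h r' hr'.1).2 (hr'.2.trans hrR)⟩
  rw [amRadius, hset, csSup_Icc hR]

theorem rkAugment_two (g a : ℝ) :
    rkAugment !![g, 0; a, g] ![1 / 2, 1 / 2] = !![g, 0, 0; a, g, 0; 1 / 2, 1 / 2, 0] := by
  ext i j
  fin_cases i <;> fin_cases j <;> simp [rkAugment]

/-- Absolute monotonicity of a two-stage singly diagonally implicit scheme with equal weights. -/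
theorem absMonoAt_sdirk_two_iff {g a r : ℝ} (hg : 0 ≤ g) (ha : 0 ≤ a) (hr : 0 ≤ r) :
    absMonoAt !![g, 0; a, g] ![1 / 2, 1 / 2] r ↔
      0 ≤ 1 + r * g - r * a ∧
        0 ≤ 2 * (1 + r * g) ^ 2 - r * (2 * (1 + r * g) - r * a) := by
  have hd : 0 < 1 + r * g := by positivity
  set d := 1 + r * g with hd_def
  have hM : (1 : Matrix (Fin 3) (Fin 3) ℝ) + r • !![g, 0, 0; a, g, 0; 1 / 2, 1 / 2, 0] =
      !![d, 0, 0; r * a, d, 0; r / 2, r / 2, 1] := by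
    ext i j
    fin_cases i <;> fin_cases j <;> simp [hd_def, div_eq_mul_inv]
  set N : Matrix (Fin 3) (Fin 3) ℝ :=
    !![1 / d, 0, 0; -(r * a) / d ^ 2, 1 / d, 0;
      -(r * (d - r * a)) / (2 * d ^ 2), -r / (2 * d), 1] with hN
  have hinv : !![d, 0, 0; r * a, d, 0; r / 2, r / 2, 1] * N = 1 := by
    ext i j
    fin_cases i <;> fin_cases j <;> simp [hN, Matrix.mul_apply, Fin.sum_univ_three] <;>
      field_simp <;> ring
  have hNK : N * !![g, 0, 0; a, g, 0; 1 / 2, 1 / 2, 0] =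
      !![g / d, 0, 0; a / d ^ 2, g / d, 0; (d - r * a) / (2 * d ^ 2), 1 / (2 * d), 0] := by
    ext i j
    fin_cases i <;> fin_cases j <;> simp [hN, Matrix.mul_apply, Fin.sum_univ_three] <;>
      field_simp <;> rw [hd_def] <;> ring
  have hNe : N.mulVec (fun _ => 1) =
      ![1 / d, (d - r * a) / d ^ 2,
        (2 * d ^ 2 - r * (2 * d - r * a)) / (2 * d ^ 2)] := by
    ext i
    fin_cases i <;> simp [hN, Matrix.mulVec, dotProduct, Fin.sum_univ_three] <;>
      field_simp <;> ring
  have hunit : IsUnit !![d, 0, 0; r * a, d, 0; r / 2, r / 2, 1] :=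
    IsUnit.of_mul_eq_one _ hinv
  simp only [absMonoAt, rkAugment_two, Nat.reduceAdd, hM, Matrix.inv_eq_right_inv hinv, hNK, hNe]
  constructor
  · rintro ⟨-, -, h⟩
    have h1 : 0 ≤ (d - r * a) / d ^ 2 := h 1
    have h2 : 0 ≤ (2 * d ^ 2 - r * (2 * d - r * a)) / (2 * d ^ 2) := h 2
    rw [le_div_iff₀ (by positivity), zero_mul] at h1 h2
    exact ⟨h1, h2⟩
  · rintro ⟨h1, h2⟩
    refine ⟨hunit, fun i j => ?_, fun i => ?_⟩
    · fin_cases i <;> fin_cases j <;> simp <;> positivity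
    · fin_cases i
      · exact (one_div_pos.2 hd).le
      · exact div_nonneg h1 (by positivity)
      · exact div_nonneg h2 (by positivity)

/-- For the IMEX SSP2(2,2,2) method, the radius of absolute monotonicity of the
explicit scheme `A = [[0,0],[1,0]]`, `b = (1/2,1/2)` equals `1`, and that of the
implicit scheme `Ã = [[γ,0],[1−2γ,γ]]`, `b̃ = (1/2,1/2)`, `γ = 1 − 1/√2`,
equals `1 + √2`. -/
theorem ssp222_amRadii :
    amRadius !![(0 : ℝ), 0; 1, 0] ![1 / 2, 1 / 2] = 1 ∧
    amRadius !![1 - 1 / Real.sqrt 2, 0; 1 - 2 * (1 - 1 / Real.sqrt 2), 1 - 1 / Real.sqrt 2]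
      ![1 / 2, 1 / 2] = 1 + Real.sqrt 2 := by
  constructor
  · refine amRadius_eq_of_absMonoAt_iff zero_le_one fun r hr => ?_
    rw [absMonoAt_sdirk_two_iff le_rfl zero_le_one hr]
    constructor
    · rintro ⟨h, -⟩
      linarith
    · intro h
      exact ⟨by linarith, by nlinarith [sq_nonneg (r - 1)]⟩
  · have hsq : Real.sqrt 2 ^ 2 = 2 := Real.sq_sqrt zero_le_two
    have hlo : 1.4 < Real.sqrt 2 := Real.lt_sqrt_of_sq_lt (by norm_num)
    have hhi : Real.sqrt 2 < 1.5 := by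
      rw [Real.sqrt_lt' (by norm_num)]
      norm_num
    have hdiv : 1 / Real.sqrt 2 = Real.sqrt 2 / 2 := by
      field_simp
      exact hsq.symm
    rw [hdiv]
    generalize Real.sqrt 2 = q at *
    refine amRadius_eq_of_absMonoAt_iff (by linarith) fun r hr => ?_
    rw [absMonoAt_sdirk_two_iff (by linarith) (by linarith) hr]
    have hstab : 2 * (1 + r * (1 - q / 2)) ^ 2 -
        r * (2 * (1 + r * (1 - q / 2)) - r * (1 - 2 * (1 - q / 2))) =
          2 * (q - 1) * (1 + q - r) := by
      linear_combination (r ^ 2 / 2 - 2) * hsq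
    rw [hstab]
    constructor
    · rintro ⟨-, h⟩
      have := nonneg_of_mul_nonneg_right h (by linarith : 0 < 2 * (q - 1))
      linarith
    · intro h
      exact ⟨by nlinarith, mul_nonneg (by linarith) (by linarith)⟩
end
end

section
/- For the IMEX pair (A, Ã) of the method SSP2(3,3,2), the region of absolute monotonicity is exactly ℛ(A, Ã) = {(r, r̃) : 0 ≤ r ≤ 1 and 0 ≤ r̃ ≤ φ(r)}, where φ(r) = (1/4)·(−28 + 9r) + (1/4)·√(1264 − 984r + 201r²); in particular the first coordinate r is necessarily bounded by 1. -/
open Matrix Set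

noncomputable section

/-- The inverse of the lower triangular matrices that occur as `I + rK + r̃K̃`. -/
lemma inv_lowerTriangular {d h : ℝ} (c g k : ℝ) (hd : d ≠ 0) (hh : h ≠ 0) :
    IsUnit !![d, 0, 0, 0; c, d, 0, 0; g, g, h, 0; k, k, k, 1] ∧
    (!![d, 0, 0, 0; c, d, 0, 0; g, g, h, 0; k, k, k, 1])⁻¹ =
      !![1 / d, 0, 0, 0;
        -c / d ^ 2, 1 / d, 0, 0;
        -g * (d - c) / (d ^ 2 * h), -g / (d * h), 1 / h, 0;
        -k * (d - c) * (h - g) / (d ^ 2 * h), -k * (h - g) / (d * h), -k / h, 1] := by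
  have hmul : !![d, 0, 0, 0; c, d, 0, 0; g, g, h, 0; k, k, k, 1] *
      !![1 / d, 0, 0, 0;
        -c / d ^ 2, 1 / d, 0, 0;
        -g * (d - c) / (d ^ 2 * h), -g / (d * h), 1 / h, 0;
        -k * (d - c) * (h - g) / (d ^ 2 * h), -k * (h - g) / (d * h), -k / h, 1] = 1 := by
    ext i j
    fin_cases i <;> fin_cases j <;>
      simp [Matrix.mul_apply, Fin.sum_univ_four] <;> field_simp <;> ring
  exact ⟨(Matrix.isUnit_iff_isUnit_det _).2 (Matrix.isUnit_det_of_right_inverse hmul),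
    Matrix.inv_eq_right_inv hmul⟩

lemma rkAugment_explicit :
    rkAugment !![(0 : ℝ), 0, 0; 1 / 2, 0, 0; 1 / 2, 1 / 2, 0] ![1 / 3, 1 / 3, 1 / 3] =
      !![0, 0, 0, 0; 1 / 2, 0, 0, 0; 1 / 2, 1 / 2, 0, 0; 1 / 3, 1 / 3, 1 / 3, 0] := by
  ext i j
  fin_cases i <;> fin_cases j <;> simp [rkAugment]

lemma rkAugment_implicit :
    rkAugment !![(1 : ℝ) / 5, 0, 0; 1 / 10, 1 / 5, 0; 1 / 3, 1 / 3, 1 / 3]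
        ![1 / 3, 1 / 3, 1 / 3] =
      !![1 / 5, 0, 0, 0; 1 / 10, 1 / 5, 0, 0; 1 / 3, 1 / 3, 1 / 3, 0;
        1 / 3, 1 / 3, 1 / 3, 0] := by
  ext i j
  fin_cases i <;> fin_cases j <;> simp [rkAugment]

lemma le_two_of_boundary_nonneg {x y : ℝ} (hx : 0 ≤ x) (hx1 : x ≤ 1) (hy : 0 ≤ y)
    (hP : 0 ≤ 60 - 60 * x - 28 * y + 9 * x * y + 15 * x ^ 2 - 2 * y ^ 2) : y ≤ 2 := by
  have hy4 : y ≤ 4 := by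
    nlinarith [mul_nonneg hx (sub_nonneg.2 hx1), mul_nonneg hy (sub_nonneg.2 hx1)]
  nlinarith [mul_nonneg hx (sub_nonneg.2 hx1), mul_nonneg hx (sub_nonneg.2 hy4)]

/-- Absolute monotonicity of SSP2(3,3,2) at a single point. -/
lemma absMonoPairAt_ssp332_iff {x y : ℝ} (hx : 0 ≤ x) (hy : 0 ≤ y) :
    absMonoPairAt !![(0 : ℝ), 0, 0; 1 / 2, 0, 0; 1 / 2, 1 / 2, 0]
      !![(1 : ℝ) / 5, 0, 0; 1 / 10, 1 / 5, 0; 1 / 3, 1 / 3, 1 / 3]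
      ![1 / 3, 1 / 3, 1 / 3] ![1 / 3, 1 / 3, 1 / 3] x y ↔
    x ≤ 1 ∧ 0 ≤ 60 - 60 * x - 28 * y + 9 * x * y + 15 * x ^ 2 - 2 * y ^ 2 := by
  obtain ⟨d, hd⟩ : ∃ d, d = 1 + y / 5 := ⟨_, rfl⟩
  obtain ⟨c, hc⟩ : ∃ c, c = x / 2 + y / 10 := ⟨_, rfl⟩
  obtain ⟨g, hg⟩ : ∃ g, g = x / 2 + y / 3 := ⟨_, rfl⟩
  obtain ⟨h, hh⟩ : ∃ h, h = 1 + y / 3 := ⟨_, rfl⟩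
  obtain ⟨k, hk⟩ : ∃ k, k = (x + y) / 3 := ⟨_, rfl⟩
  have hd0 : 0 < d := by rw [hd]; positivity
  have hh0 : 0 < h := by rw [hh]; positivity
  have hM : (1 : Matrix (Fin 4) (Fin 4) ℝ)
      + x • !![0, 0, 0, 0; 1 / 2, 0, 0, 0; 1 / 2, 1 / 2, 0, 0; 1 / 3, 1 / 3, 1 / 3, 0]
      + y • !![1 / 5, 0, 0, 0; 1 / 10, 1 / 5, 0, 0; 1 / 3, 1 / 3, 1 / 3, 0;
        1 / 3, 1 / 3, 1 / 3, 0] =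
      !![d, 0, 0, 0; c, d, 0, 0; g, g, h, 0; k, k, k, 1] := by
    ext i j
    fin_cases i <;> fin_cases j <;> simp [hd, hc, hg, hh, hk] <;> ring
  obtain ⟨hunit, hinv⟩ := inv_lowerTriangular c g k hd0.ne' hh0.ne'
  simp only [absMonoPairAt, rkAugment_explicit, rkAugment_implicit, Nat.reduceAdd, hM, hinv]
  constructor
  · rintro ⟨-, hK, hKt, -⟩
    have h30 := hK 3 0
    have h10 := hKt 1 0
    simp [Matrix.mul_apply, Fin.sum_univ_four] at h30 h10
    have e30 : -(k * (h - g)) / (d * h) * 2⁻¹ + -k / h * 2⁻¹ + 3⁻¹ =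
        (2 * d * h - 3 * k * (h - g + d)) / (6 * (d * h)) := by
      field_simp
      ring
    have e10 : -c / d ^ 2 * 5⁻¹ + d⁻¹ * 10⁻¹ = (d - 2 * c) / (10 * d ^ 2) := by
      field_simp
      ring
    rw [e30, le_div_iff₀ (by positivity), zero_mul] at h30
    rw [e10, le_div_iff₀ (by positivity), zero_mul] at h10
    subst hd hc hg hh hk
    exact ⟨by linarith, by linarith⟩
  · rintro ⟨hx1, hP⟩
    have hy2 := le_two_of_boundary_nonneg hx hx1 hy hP
    have hxy : 0 ≤ x * y := mul_nonneg hx hy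
    have hc0 : 0 ≤ c := by rw [hc]; positivity
    have hg0 : 0 ≤ g := by rw [hg]; positivity
    have hk0 : 0 ≤ k := by rw [hk]; positivity
    have hgh : 0 ≤ h - g := by linarith
    have hgd : 0 ≤ d - g := by linarith
    have hcd : 0 ≤ d - 2 * c := by linarith
    have hkh : 0 ≤ h - k := by linarith
    refine ⟨hunit, ?_, ?_, ?_⟩
    · have n20 : 0 ≤ (d - g) / (2 * (d * h)) := by positivity
      have n30 : 0 ≤ (2 * d * h - 3 * k * (h - g + d)) / (6 * (d * h)) := by
        refine div_nonneg ?_ (by positivity)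
        subst hd hc hg hh hk
        linarith
      have n31 : 0 ≤ (2 * h - 3 * k) / (6 * h) :=
        div_nonneg (by linarith) (by positivity)
      intro i j
      fin_cases i <;> fin_cases j <;> simp [Matrix.mul_apply, Fin.sum_univ_four]
      · exact hd0.le
      · exact n20.trans_eq (by field_simp; ring)
      · exact hh0.le
      · exact n30.trans_eq (by field_simp; ring)
      · exact n31.trans_eq (by field_simp; ring)
    · have n10 : 0 ≤ (d - 2 * c) / (10 * d ^ 2) := by positivity
      have n20 : 0 ≤ (d * (10 * d - 9 * g) + 6 * g * c) / (30 * (d ^ 2 * h)) := by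
        have : 0 ≤ 10 * d - 9 * g := by linarith
        positivity
      have n21 : 0 ≤ (5 * d - 3 * g) / (15 * (d * h)) :=
        div_nonneg (by linarith) (by positivity)
      have n30 : 0 ≤ (d * (10 * d * (h - k) - 9 * k * (h - g)) + 6 * c * k * (h - g)) /
          (30 * (d ^ 2 * h)) := by
        have : 0 ≤ 10 * d * (h - k) - 9 * k * (h - g) := by
          subst hd hc hg hh hk
          nlinarith
        positivity
      have n31 : 0 ≤ (5 * d * (h - k) - 3 * k * (h - g)) / (15 * (d * h)) := by
        refine div_nonneg ?_ (by positivity)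
        subst hd hc hg hh hk
        nlinarith
      have n32 : 0 ≤ (h - k) / (3 * h) := by positivity
      intro i j
      fin_cases i <;> fin_cases j <;> simp [Matrix.mul_apply, Fin.sum_univ_four]
      · exact hd0.le
      · exact n10.trans_eq (by field_simp; ring)
      · exact hd0.le
      · exact n20.trans_eq (by field_simp; ring)
      · exact n21.trans_eq (by field_simp; ring)
      · exact hh0.le
      · exact n30.trans_eq (by field_simp; ring)
      · exact n31.trans_eq (by field_simp; ring)
      · exact n32.trans_eq (by field_simp; ring)
    · have n1 : 0 ≤ (d - c) / d ^ 2 := div_nonneg (by linarith) (by positivity)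
      have n2 : 0 ≤ (d ^ 2 - g * (2 * d - c)) / (d ^ 2 * h) := by
        refine div_nonneg ?_ (by positivity)
        have : 0 ≤ y * (15 - 10 * x - 2 * y) := mul_nonneg hy (by linarith)
        subst hd hc hg hh hk
        linarith
      have n3 : 0 ≤ (d * (d * (h - k) - 2 * k * (h - g)) + c * k * (h - g)) / (d ^ 2 * h) := by
        have : 0 ≤ d * (h - k) - 2 * k * (h - g) := by
          subst hd hc hg hh hk
          nlinarith [sq_nonneg x, sq_nonneg y]
        positivity
      intro i
      fin_cases i <;> simp [Matrix.mulVec, dotProduct, Fin.sum_univ_four]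
      · exact hd0.le
      · exact n1.trans_eq (by field_simp; ring)
      · exact n2.trans_eq (by field_simp; ring)
      · exact n3.trans_eq (by field_simp; ring)

/-- The region of absolute monotonicity of the IMEX SSP2(3,3,2) method
(explicit part `A = [[0,0,0],[1/2,0,0],[1/2,1/2,0]]`, `b = (1/3,1/3,1/3)`;
implicit part `Ã = [[1/5,0,0],[1/10,1/5,0],[1/3,1/3,1/3]]`, `b̃ = (1/3,1/3,1/3)`)
is exactly `{(r, r̃) : 0 ≤ r ≤ 1, 0 ≤ r̃ ≤ φ(r)}` with
`φ(r) = (1/4)(−28 + 9r) + (1/4)√(1264 − 984r + 201r²)`; in particular the first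
coordinate is necessarily bounded by `1`. -/
theorem ssp332_amRegion :
    amRegion !![(0 : ℝ), 0, 0; 1 / 2, 0, 0; 1 / 2, 1 / 2, 0]
      !![(1 : ℝ) / 5, 0, 0; 1 / 10, 1 / 5, 0; 1 / 3, 1 / 3, 1 / 3]
      ![1 / 3, 1 / 3, 1 / 3] ![1 / 3, 1 / 3, 1 / 3] =
    {p : ℝ × ℝ | 0 ≤ p.1 ∧ p.1 ≤ 1 ∧ 0 ≤ p.2 ∧
      p.2 ≤ (1 / 4) * (-28 + 9 * p.1)
              + (1 / 4) * Real.sqrt (1264 - 984 * p.1 + 201 * p.1 ^ 2)} := by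
  ext ⟨x, y⟩
  simp only [amRegion, Set.mem_ofPred_eq]
  have hdisc : ∀ {x : ℝ}, x ≤ 1 → 0 ≤ 1264 - 984 * x + 201 * x ^ 2 := fun hx => by
    nlinarith [mul_self_nonneg (1 - x)]
  constructor
  · rintro ⟨hx, hy, H⟩
    obtain ⟨hx1, hP⟩ := (absMonoPairAt_ssp332_iff hx hy).1 (H x ⟨hx, le_rfl⟩ y ⟨hy, le_rfl⟩)
    refine ⟨hx, hx1, hy, ?_⟩
    have : 4 * y + 28 - 9 * x ≤ Real.sqrt (1264 - 984 * x + 201 * x ^ 2) :=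
      Real.le_sqrt_of_sq_le (by nlinarith)
    linarith
  · rintro ⟨hx, hx1, hy, hle⟩
    have hP : 0 ≤ 60 - 60 * x - 28 * y + 9 * x * y + 15 * x ^ 2 - 2 * y ^ 2 := by
      have h1 : 4 * y + 28 - 9 * x ≤ Real.sqrt (1264 - 984 * x + 201 * x ^ 2) := by linarith
      have h2 := (Real.le_sqrt' (by linarith)).1 h1
      nlinarith
    have hy2 := le_two_of_boundary_nonneg hx hx1 hy hP
    refine ⟨hx, hy, fun r ⟨hr, hrx⟩ t ⟨ht, hty⟩ => (absMonoPairAt_ssp332_iff hr ht).2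
      ⟨hrx.trans hx1, ?_⟩⟩
    have hfst : 0 ≤ (x - r) * (60 - 9 * y - 15 * (x + r)) :=
      mul_nonneg (by linarith) (by linarith)
    have hsnd : 0 ≤ (y - t) * (28 - 9 * r + 2 * (y + t)) :=
      mul_nonneg (by linarith) (by linarith)
    linarith
end
end

section
/- For the method SSP2(3,3,2), the radius of absolute monotonicity of the explicit scheme (A, b) equals 2, and the radius of absolute monotonicity of the implicit scheme (Ã, b̃) equals (5/9)·(√70 − 4). -/
open Matrix Set

noncomputable section

theorem absMonoAt_iff_of_mul_eq_one {s : ℕ} {A : Matrix (Fin s) (Fin s) ℝ} {b : Fin s → ℝ} {r : ℝ}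
    {L : Matrix (Fin (s + 1)) (Fin (s + 1)) ℝ} (hL : L * (1 + r • rkAugment A b) = 1) :
    absMonoAt A b r ↔ (∀ i j, 0 ≤ (L * rkAugment A b) i j) ∧ ∀ i, 0 ≤ (L *ᵥ fun _ => 1) i := by
  have hu : IsUnit (1 + r • rkAugment A b) := IsUnit.of_mul_eq_one_right L hL
  simp only [absMonoAt, Matrix.inv_eq_left_inv hL, hu, true_and]

theorem rkAugment_three (a₁₁ a₁₂ a₁₃ a₂₁ a₂₂ a₂₃ a₃₁ a₃₂ a₃₃ b₁ b₂ b₃ : ℝ) :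
    rkAugment !![a₁₁, a₁₂, a₁₃; a₂₁, a₂₂, a₂₃; a₃₁, a₃₂, a₃₃] ![b₁, b₂, b₃] =
      !![a₁₁, a₁₂, a₁₃, 0; a₂₁, a₂₂, a₂₃, 0; a₃₁, a₃₂, a₃₃, 0; b₁, b₂, b₃, 0] := by
  ext i j
  fin_cases i <;> fin_cases j <;> rfl

theorem ssp332_explicit_absMonoAt_iff {r : ℝ} (hr : 0 ≤ r) :
    absMonoAt !![(0 : ℝ), 0, 0; 1 / 2, 0, 0; 1 / 2, 1 / 2, 0] ![1 / 3, 1 / 3, 1 / 3] r ↔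
      r ≤ 2 := by
  obtain ⟨u, rfl⟩ : ∃ u : ℝ, r = 2 * (1 - u) := ⟨1 - r / 2, by ring⟩
  obtain ⟨L, hLdef⟩ : ∃ L : Matrix (Fin 4) (Fin 4) ℝ, L =
      !![1, 0, 0, 0; u - 1, 1, 0, 0; u * (u - 1), u - 1, 1, 0;
        2 / 3 * (u - 1) * u ^ 2, 2 / 3 * (u - 1) * u, 2 / 3 * (u - 1), 1] := ⟨_, rfl⟩
  have hL : L *
      (1 + (2 * (1 - u)) • rkAugment !![(0 : ℝ), 0, 0; 1 / 2, 0, 0; 1 / 2, 1 / 2, 0]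
        ![1 / 3, 1 / 3, 1 / 3]) = 1 := by
    rw [rkAugment_three]
    ext i j
    fin_cases i <;> fin_cases j <;>
      simp [hLdef, Matrix.mul_apply, Fin.sum_univ_four, Matrix.one_apply] <;> ring
  have hK : L *
      !![(0 : ℝ), 0, 0, 0; 1 / 2, 0, 0, 0; 1 / 2, 1 / 2, 0, 0; 1 / 3, 1 / 3, 1 / 3, 0] =
      !![0, 0, 0, 0; 1 / 2, 0, 0, 0; u / 2, 1 / 2, 0, 0; u ^ 2 / 3, u / 3, 1 / 3, 0] := by
    ext i j
    fin_cases i <;> fin_cases j <;> simp [hLdef, Matrix.mul_apply, Fin.sum_univ_four] <;> ring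
  rw [absMonoAt_iff_of_mul_eq_one hL, rkAugment_three, hK]
  constructor
  · intro h
    have h₁ := h.2 1
    simp [hLdef, Matrix.mulVec, dotProduct, Fin.sum_univ_four] at h₁
    linarith
  · intro h
    have hu : 0 ≤ u := by linarith
    refine ⟨fun i j => ?_, fun i => ?_⟩
    · fin_cases i <;> fin_cases j <;> simp <;> positivity
    · have hu₃ : 0 ≤ u ^ 3 := by positivity
      fin_cases i <;> simp [hLdef, Matrix.mulVec, dotProduct, Fin.sum_univ_four] <;> nlinarith

theorem ssp332_implicit_absMonoAt_iff {r : ℝ} (hr : 0 ≤ r) :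
    absMonoAt !![(1 : ℝ) / 5, 0, 0; 1 / 10, 1 / 5, 0; 1 / 3, 1 / 3, 1 / 3]
      ![1 / 3, 1 / 3, 1 / 3] r ↔ 0 ≤ 150 - 40 * r - 9 * r ^ 2 := by
  have hd : 0 < 5 + r := by linarith
  have hg : 0 < 3 + r := by linarith
  obtain ⟨L, hLdef⟩ : ∃ L : Matrix (Fin 4) (Fin 4) ℝ, L =
      !![5 / (5 + r), 0, 0, 0;
        -(5 * r) / (2 * (5 + r) ^ 2), 5 / (5 + r), 0, 0;
        -(5 * r * (10 + r)) / (2 * (5 + r) ^ 2 * (3 + r)), -(5 * r) / ((5 + r) * (3 + r)),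
          3 / (3 + r), 0;
        -(5 * r * (10 + r)) / (2 * (5 + r) ^ 2 * (3 + r)), -(5 * r) / ((5 + r) * (3 + r)),
          -r / (3 + r), 1] := ⟨_, rfl⟩
  have hL : L *
      (1 + r • rkAugment !![(1 : ℝ) / 5, 0, 0; 1 / 10, 1 / 5, 0; 1 / 3, 1 / 3, 1 / 3]
        ![1 / 3, 1 / 3, 1 / 3]) = 1 := by
    rw [rkAugment_three]
    ext i j
    fin_cases i <;> fin_cases j <;>
      simp [hLdef, Matrix.mul_apply, Fin.sum_univ_four, Matrix.one_apply] <;> field_simp <;> ring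
  have hK : L *
      !![(1 : ℝ) / 5, 0, 0, 0; 1 / 10, 1 / 5, 0, 0; 1 / 3, 1 / 3, 1 / 3, 0;
        1 / 3, 1 / 3, 1 / 3, 0] =
      !![1 / (5 + r), 0, 0, 0; 5 / (2 * (5 + r) ^ 2), 1 / (5 + r), 0, 0;
        5 * (10 + r) / (2 * (5 + r) ^ 2 * (3 + r)), 5 / ((5 + r) * (3 + r)), 1 / (3 + r), 0;
        5 * (10 + r) / (2 * (5 + r) ^ 2 * (3 + r)), 5 / ((5 + r) * (3 + r)), 1 / (3 + r), 0] := by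
    ext i j
    fin_cases i <;> fin_cases j <;>
      simp [hLdef, Matrix.mul_apply, Fin.sum_univ_four] <;> field_simp <;> ring
  have hv : (L *ᵥ fun _ => 1) =
      ![5 / (5 + r), 5 * (10 + r) / (2 * (5 + r) ^ 2),
        (150 - 40 * r - 9 * r ^ 2) / (2 * (5 + r) ^ 2 * (3 + r)),
        (150 - 40 * r - 9 * r ^ 2) / (2 * (5 + r) ^ 2 * (3 + r))] := by
    ext i
    fin_cases i <;> simp [hLdef, Matrix.mulVec, dotProduct, Fin.sum_univ_four] <;> field_simp <;> ring
  rw [absMonoAt_iff_of_mul_eq_one hL, rkAugment_three, hK, hv]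
  constructor
  · intro h
    have h₂ : 0 ≤ (150 - 40 * r - 9 * r ^ 2) / (2 * (5 + r) ^ 2 * (3 + r)) := h.2 2
    rwa [le_div_iff₀ (by positivity), zero_mul] at h₂
  · intro h
    have hq : 0 ≤ (150 - 40 * r - 9 * r ^ 2) / (2 * (5 + r) ^ 2 * (3 + r)) :=
      div_nonneg h (by positivity)
    refine ⟨fun i j => ?_, fun i => ?_⟩
    · fin_cases i <;> fin_cases j <;> simp <;> positivity
    · fin_cases i
      · change 0 ≤ 5 / (5 + r)
        positivity
      · change 0 ≤ 5 * (10 + r) / (2 * (5 + r) ^ 2)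
        positivity
      · exact hq
      · exact hq

/-- For the IMEX SSP2(3,3,2) method, the radius of absolute monotonicity of the
explicit scheme `A = [[0,0,0],[1/2,0,0],[1/2,1/2,0]]`, `b = (1/3,1/3,1/3)` equals `2`,
and that of the implicit scheme `Ã = [[1/5,0,0],[1/10,1/5,0],[1/3,1/3,1/3]]`,
`b̃ = (1/3,1/3,1/3)`, equals `(5/9)(√70 − 4)`. -/
theorem ssp332_amRadii :
    amRadius !![(0 : ℝ), 0, 0; 1 / 2, 0, 0; 1 / 2, 1 / 2, 0] ![1 / 3, 1 / 3, 1 / 3] = 2 ∧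
    amRadius !![(1 : ℝ) / 5, 0, 0; 1 / 10, 1 / 5, 0; 1 / 3, 1 / 3, 1 / 3]
      ![1 / 3, 1 / 3, 1 / 3] = (5 / 9) * (Real.sqrt 70 - 4) := by
  have hsq : Real.sqrt 70 ^ 2 = 70 := Real.sq_sqrt (by norm_num)
  have h4 : 4 ≤ Real.sqrt 70 := Real.le_sqrt_of_sq_le (by norm_num)
  refine ⟨amRadius_eq_of_absMonoAt_iff zero_le_two fun r => ssp332_explicit_absMonoAt_iff,
    amRadius_eq_of_absMonoAt_iff (by linarith) fun r hr => ?_⟩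
  have hfac : 150 - 40 * r - 9 * r ^ 2 =
      ((5 / 9) * (Real.sqrt 70 - 4) - r) * (9 * r + 20 + 5 * Real.sqrt 70) := by
    linear_combination -(25 / 9) * hsq
  rw [ssp332_implicit_absMonoAt_iff hr, hfac, mul_nonneg_iff_of_pos_right (by positivity),
    sub_nonneg]
end
end

section
/- For the method SSP3(3,3,3): the radius of absolute monotonicity of the explicit scheme (A, b) equals 1, the radius of absolute monotonicity of the implicit scheme (Ã, b̃) equals (5/47)·(13 − 2√7), and the region of absolute monotonicity of the pair is exactly ℛ(A, Ã) = {(r, r̃) : 0 ≤ r ≤ 1 and 0 ≤ r̃ ≤ φ(r)}, where φ(r) = (15/302)·(28 − 25r − √(180 − 192r + 21r²)). -/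
open Matrix Set

noncomputable section

/-- The augmented matrix of the explicit part of SSP3(3,3,3). -/
def ssp333K : Matrix (Fin 4) (Fin 4) ℝ :=
  !![0, 0, 0, 0; 1, 0, 0, 0; 1 / 4, 1 / 4, 0, 0; 1 / 6, 1 / 6, 2 / 3, 0]

/-- The augmented matrix of the implicit part of SSP3(3,3,3). -/
def ssp333Kt : Matrix (Fin 4) (Fin 4) ℝ :=
  !![0, 0, 0, 0; 14 / 15, 1 / 15, 0, 0; 7 / 30, 1 / 5, 1 / 15, 0; 1 / 6, 1 / 6, 2 / 3, 0]

/-- The inverse of `1 + r • K + t • K̃` for SSP3(3,3,3). -/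
def ssp333Inv (r t : ℝ) : Matrix (Fin 4) (Fin 4) ℝ :=
  !![1, 0, 0, 0;
    -(15 * r + 14 * t) / (15 + t), 15 / (15 + t), 0, 0;
    -(15 * r + 14 * t) * (15 - 15 * r - 11 * t) / (4 * (15 + t) ^ 2),
      -(15 * (15 * r + 12 * t)) / (4 * (15 + t) ^ 2), 15 / (15 + t), 0;
    -(r + t) * ((15 + t) ^ 2 - 2 * (15 * r + 14 * t) * (15 + t)
        + (15 * r + 14 * t) * (15 * r + 12 * t)) / (6 * (15 + t) ^ 2),
      -(15 * (r + t) * (15 - 15 * r - 11 * t)) / (6 * (15 + t) ^ 2),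
      -(10 * (r + t)) / (15 + t), 1]

theorem rkAugment_ssp333_explicit :
    rkAugment !![(0 : ℝ), 0, 0; 1, 0, 0; 1 / 4, 1 / 4, 0] ![1 / 6, 1 / 6, 2 / 3] = ssp333K := by
  ext i j
  fin_cases i <;> fin_cases j <;> simp [rkAugment, ssp333K]

theorem rkAugment_ssp333_implicit :
    rkAugment !![(0 : ℝ), 0, 0; 14 / 15, 1 / 15, 0; 7 / 30, 1 / 5, 1 / 15]
      ![1 / 6, 1 / 6, 2 / 3] = ssp333Kt := by
  ext i j
  fin_cases i <;> fin_cases j <;> simp [rkAugment, ssp333Kt]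

theorem ssp333_mul_inv {r t : ℝ} (ht : 0 ≤ t) :
    (1 + r • ssp333K + t • ssp333Kt) * ssp333Inv r t = 1 := by
  have hD : 15 + t ≠ 0 := by positivity
  ext i j
  fin_cases i <;> fin_cases j <;>
    simp [ssp333K, ssp333Kt, ssp333Inv, Matrix.mul_apply, Fin.sum_univ_four,
      Matrix.one_apply] <;>
    field_simp <;> ring

theorem isUnit_ssp333 {r t : ℝ} (ht : 0 ≤ t) :
    IsUnit (1 + r • ssp333K + t • ssp333Kt) :=
  IsUnit.of_mul_eq_one _ (ssp333_mul_inv ht)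

theorem ssp333_inv_eq {r t : ℝ} (ht : 0 ≤ t) :
    (1 + r • ssp333K + t • ssp333Kt)⁻¹ = ssp333Inv r t :=
  Matrix.inv_eq_right_inv (ssp333_mul_inv ht)

theorem ssp333Inv_mul_K {r t : ℝ} (ht : 0 ≤ t) :
    ssp333Inv r t * ssp333K =
      !![0, 0, 0, 0;
        15 / (15 + t), 0, 0, 0;
        15 * (15 - 15 * r - 11 * t) / (4 * (15 + t) ^ 2), 15 / (4 * (15 + t)), 0, 0;
        (225 * (1 - r) ^ 2 - (420 - 375 * r) * t + 151 * t ^ 2) / (6 * (15 + t) ^ 2),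
          (15 - 15 * r - 14 * t) / (6 * (15 + t)), 2 / 3, 0] := by
  have hD : 15 + t ≠ 0 := by positivity
  ext i j
  fin_cases i <;> fin_cases j <;>
    simp [ssp333K, ssp333Inv, Matrix.mul_apply, Fin.sum_univ_four] <;>
    field_simp <;> ring

theorem ssp333Inv_mul_Kt {r t : ℝ} (ht : 0 ≤ t) :
    ssp333Inv r t * ssp333Kt =
      !![0, 0, 0, 0;
        14 / (15 + t), 1 / (15 + t), 0, 0;
        7 * (15 - 15 * r - 11 * t) / (2 * (15 + t) ^ 2),
          (12 * (15 + t) - (15 * r + 12 * t)) / (4 * (15 + t) ^ 2), 1 / (15 + t), 0;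
        ((15 + t) ^ 2 - 28 * (r + t) * (15 + t) + 14 * (r + t) * (15 * r + 12 * t))
            / (6 * (15 + t) ^ 2),
          ((15 + t) * (15 + t - 13 * (r + t)) + (r + t) * (15 * r + 12 * t))
            / (6 * (15 + t) ^ 2),
          2 * (15 - r) / (3 * (15 + t)), 0] := by
  have hD : 15 + t ≠ 0 := by positivity
  ext i j
  fin_cases i <;> fin_cases j <;>
    simp [ssp333Kt, ssp333Inv, Matrix.mul_apply, Fin.sum_univ_four] <;>
    field_simp <;> ring

theorem ssp333Inv_mulVec_one {r t : ℝ} (ht : 0 ≤ t) :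
    (ssp333Inv r t).mulVec (fun _ => 1) =
      ![1, (15 - 15 * r - 14 * t) / (15 + t),
        (60 * (15 + t) - (15 * r + 14 * t) * (15 - 15 * r - 11 * t) - 15 * (15 * r + 12 * t))
          / (4 * (15 + t) ^ 2),
        (6 * (15 + t) ^ 2 - (r + t) * (15 - 15 * r - 13 * t) ^ 2
            + 2 * t * (r + t) * (15 * r + 14 * t)
            - 15 * (r + t) * (15 - 15 * r - 11 * t) - 60 * (r + t) * (15 + t))
          / (6 * (15 + t) ^ 2)] := by
  have hD : 15 + t ≠ 0 := by positivity
  ext i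
  fin_cases i <;>
    simp [ssp333Inv, Matrix.mulVec, dotProduct, Fin.sum_univ_four] <;>
    field_simp <;> ring

theorem ssp333Inv_mul_K_nonneg {r t : ℝ} (ht : 0 ≤ t) (hlin : 15 * r + 14 * t ≤ 15)
    (hquad : 0 ≤ 225 * (1 - r) ^ 2 - (420 - 375 * r) * t + 151 * t ^ 2) (i j : Fin 4) :
    0 ≤ (ssp333Inv r t * ssp333K) i j := by
  have hlin' : 0 ≤ 15 - 15 * r - 14 * t := by linarith
  have hlin'' : 0 ≤ 15 - 15 * r - 11 * t := by linarith
  rw [ssp333Inv_mul_K ht]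
  fin_cases i <;> fin_cases j <;> simp <;> positivity

theorem ssp333Inv_mul_Kt_nonneg {r t : ℝ} (hr : 0 ≤ r) (ht : 0 ≤ t)
    (hlin : 15 * r + 14 * t ≤ 15)
    (hquad : 0 ≤ (15 + t) ^ 2 - 28 * (r + t) * (15 + t) + 14 * (r + t) * (15 * r + 12 * t))
    (i j : Fin 4) : 0 ≤ (ssp333Inv r t * ssp333Kt) i j := by
  have h₁ : 0 ≤ 15 - 15 * r - 11 * t := by linarith
  have h₂ : 0 ≤ 12 * (15 + t) - (15 * r + 12 * t) := by linarith
  have h₃ : 0 ≤ 15 + t - 13 * (r + t) := by linarith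
  have h₄ : 0 ≤ 15 - r := by linarith
  rw [ssp333Inv_mul_Kt ht]
  fin_cases i <;> fin_cases j <;> simp <;> positivity

theorem ssp333Inv_mulVec_one_nonneg {r t : ℝ} (hr : 0 ≤ r) (ht : 0 ≤ t)
    (hlin : 15 * r + 14 * t ≤ 15) (i : Fin 4) :
    0 ≤ (ssp333Inv r t).mulVec (fun _ => 1) i := by
  have h₁ : 0 ≤ 15 - 15 * r - 14 * t := by linarith
  have h₂ : 0 ≤ 60 * (15 + t) - (15 * r + 14 * t) * (15 - 15 * r - 11 * t)
      - 15 * (15 * r + 12 * t) := by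
    have := mul_le_mul hlin (show 15 - 15 * r - 11 * t ≤ 15 by linarith) (by linarith)
      (by norm_num)
    linarith
  have h₃ : 0 ≤ 6 * (15 + t) ^ 2 - (r + t) * (15 - 15 * r - 13 * t) ^ 2
      + 2 * t * (r + t) * (15 * r + 14 * t)
      - 15 * (r + t) * (15 - 15 * r - 11 * t) - 60 * (r + t) * (15 + t) := by
    have hs : 0 ≤ r + t := by positivity
    have hsD : 15 * (r + t) ≤ 15 + t := by linarith
    have hsq : (15 - 15 * r - 13 * t) ^ 2 ≤ 15 * (15 + t) := by nlinarith
    have e₁ : (r + t) * (15 - 15 * r - 13 * t) ^ 2 ≤ (15 + t) ^ 2 := by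
      nlinarith [mul_le_mul_of_nonneg_left hsq hs]
    have e₂ : 15 * (r + t) * (15 - 15 * r - 11 * t) ≤ (15 + t) ^ 2 := by
      rw [sq]
      exact mul_le_mul hsD (by linarith) (by linarith) (by linarith)
    have e₃ : 60 * (r + t) * (15 + t) ≤ 4 * (15 + t) ^ 2 := by nlinarith
    have e₄ : 0 ≤ 2 * t * (r + t) * (15 * r + 14 * t) := by positivity
    linarith
  rw [ssp333Inv_mulVec_one ht]
  fin_cases i <;> simp <;> positivity

theorem absMonoAt_ssp333_explicit_iff {r : ℝ} (hr : 0 ≤ r) :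
    absMonoAt !![(0 : ℝ), 0, 0; 1, 0, 0; 1 / 4, 1 / 4, 0] ![1 / 6, 1 / 6, 2 / 3] r ↔ r ≤ 1 := by
  have hM : 1 + r • ssp333K = 1 + r • ssp333K + (0 : ℝ) • ssp333Kt := by simp
  simp only [absMonoAt, rkAugment_ssp333_explicit]
  rw [hM, ssp333_inv_eq le_rfl]
  constructor
  · rintro ⟨-, -, h⟩
    have := h 1
    rw [ssp333Inv_mulVec_one le_rfl] at this
    simp at this
    linarith
  · intro h
    refine ⟨isUnit_ssp333 le_rfl, ssp333Inv_mul_K_nonneg le_rfl (by linarith) ?_,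
      ssp333Inv_mulVec_one_nonneg hr le_rfl (by linarith)⟩
    have := sq_nonneg (1 - r)
    linarith

theorem absMonoAt_ssp333_implicit_iff {t : ℝ} (ht : 0 ≤ t) :
    absMonoAt !![(0 : ℝ), 0, 0; 14 / 15, 1 / 15, 0; 7 / 30, 1 / 5, 1 / 15]
      ![1 / 6, 1 / 6, 2 / 3] t ↔ 14 * t ≤ 15 ∧ 0 ≤ 141 * t ^ 2 - 390 * t + 225 := by
  have hM : 1 + t • ssp333Kt = 1 + (0 : ℝ) • ssp333K + t • ssp333Kt := by simp
  simp only [absMonoAt, rkAugment_ssp333_implicit]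
  rw [hM, ssp333_inv_eq ht]
  constructor
  · rintro ⟨-, h, h'⟩
    have h₁ := h' 1
    have h₂ := h 3 0
    rw [ssp333Inv_mulVec_one ht] at h₁
    rw [ssp333Inv_mul_Kt ht] at h₂
    simp at h₁ h₂
    rw [le_div_iff₀ (by positivity)] at h₁ h₂
    constructor <;> linarith
  · rintro ⟨h₁, h₂⟩
    exact ⟨isUnit_ssp333 ht, ssp333Inv_mul_Kt_nonneg le_rfl ht (by linarith) (by linarith),
      ssp333Inv_mulVec_one_nonneg le_rfl ht (by linarith)⟩

theorem absMonoPairAt_ssp333_iff {r t : ℝ} (hr : 0 ≤ r) (ht : 0 ≤ t) :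
    absMonoPairAt !![(0 : ℝ), 0, 0; 1, 0, 0; 1 / 4, 1 / 4, 0]
      !![(0 : ℝ), 0, 0; 14 / 15, 1 / 15, 0; 7 / 30, 1 / 5, 1 / 15]
      ![1 / 6, 1 / 6, 2 / 3] ![1 / 6, 1 / 6, 2 / 3] r t ↔
    15 * r + 14 * t ≤ 15 ∧ 0 ≤ 225 * (1 - r) ^ 2 - (420 - 375 * r) * t + 151 * t ^ 2 := by
  simp only [absMonoPairAt, rkAugment_ssp333_explicit, rkAugment_ssp333_implicit]
  rw [ssp333_inv_eq ht]
  constructor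
  · rintro ⟨-, h, -, h'⟩
    have h₁ := h' 1
    have h₂ := h 3 0
    rw [ssp333Inv_mulVec_one ht] at h₁
    rw [ssp333Inv_mul_K ht] at h₂
    simp at h₁ h₂
    rw [le_div_iff₀ (by positivity)] at h₁ h₂
    constructor <;> linarith
  · rintro ⟨h₁, h₂⟩
    refine ⟨isUnit_ssp333 ht, ssp333Inv_mul_K_nonneg ht h₁ h₂,
      ssp333Inv_mul_Kt_nonneg hr ht h₁ ?_, ssp333Inv_mulVec_one_nonneg hr ht h₁⟩
    have : 0 ≤ (r + t) * (30 + 2 * t - (15 * r + 12 * t)) :=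
      mul_nonneg (by positivity) (by linarith)
    linarith

/-- The linear and quadratic conditions for the implicit part cut out an interval. -/
theorem ssp333_implicit_conditions_iff {t : ℝ} :
    14 * t ≤ 15 ∧ 0 ≤ 141 * t ^ 2 - 390 * t + 225 ↔ t ≤ (5 / 47) * (13 - 2 * √7) := by
  have h7 : √7 ^ 2 = 7 := Real.sq_sqrt (by norm_num)
  have h7' : 2 < √7 := Real.lt_sqrt_of_sq_lt (by norm_num)
  have hfac : 141 * t ^ 2 - 390 * t + 225 =
      141 * ((5 / 47) * (13 - 2 * √7) - t) * ((5 / 47) * (13 + 2 * √7) - t) := by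
    linear_combination (141 * (25 / 2209) * 4) * h7
  rw [hfac]
  constructor
  · rintro ⟨h₁, h₂⟩
    have := nonneg_of_mul_nonneg_left h₂ (by linarith)
    linarith
  · intro h
    refine ⟨by linarith, mul_nonneg (by linarith) (by linarith)⟩

/-- The linear and quadratic conditions for the pair describe the region below the graph of `φ`. -/
theorem ssp333_pair_conditions_iff {r t : ℝ} (ht : 0 ≤ t) :
    15 * r + 14 * t ≤ 15 ∧ 0 ≤ 225 * (1 - r) ^ 2 - (420 - 375 * r) * t + 151 * t ^ 2 ↔
    r ≤ 1 ∧ t ≤ (15 / 302) * (28 - 25 * r - √(180 - 192 * r + 21 * r ^ 2)) := by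
  have hdisc : r ≤ 1 → √(180 - 192 * r + 21 * r ^ 2) ^ 2 = 180 - 192 * r + 21 * r ^ 2 :=
    fun h => Real.sq_sqrt (by nlinarith [mul_nonneg (sub_nonneg.2 h) (sub_nonneg.2 h)])
  have hS : 0 ≤ √(180 - 192 * r + 21 * r ^ 2) := Real.sqrt_nonneg _
  set S := √(180 - 192 * r + 21 * r ^ 2)
  have hfac : r ≤ 1 → 225 * (1 - r) ^ 2 - (420 - 375 * r) * t + 151 * t ^ 2 =
      151 * ((15 / 302) * (28 - 25 * r - S) - t) * ((15 / 302) * (28 - 25 * r + S) - t) := by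
    intro h
    linear_combination (151 * (15 / 302) ^ 2) * hdisc h
  constructor
  · rintro ⟨h₁, h₂⟩
    have hr : r ≤ 1 := by linarith
    refine ⟨hr, ?_⟩
    rw [hfac hr] at h₂
    by_cases hpos : 0 < (15 / 302) * (28 - 25 * r + S) - t
    · have := nonneg_of_mul_nonneg_left h₂ hpos
      linarith
    · linarith
  · rintro ⟨hr, h⟩
    refine ⟨?_, ?_⟩
    · have hS' : 3 - 3 * (1 - r) ≤ S := by
        apply Real.le_sqrt_of_sq_le
        nlinarith
      nlinarith [hdisc hr]
    · rw [hfac hr]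
      exact mul_nonneg (by linarith) (by linarith)

/-- For the IMEX SSP3(3,3,3) method (explicit part `A = [[0,0,0],[1,0,0],[1/4,1/4,0]]`,
`b = (1/6,1/6,2/3)`; implicit part `Ã = [[0,0,0],[14/15,1/15,0],[7/30,1/5,1/15]]`,
`b̃ = (1/6,1/6,2/3)`): the radius of absolute monotonicity of the explicit scheme
equals `1`, that of the implicit scheme equals `(5/47)(13 − 2√7)`, and the region of
absolute monotonicity of the pair is exactly `{(r, r̃) : 0 ≤ r ≤ 1, 0 ≤ r̃ ≤ φ(r)}`
with `φ(r) = (15/302)(28 − 25r − √(180 − 192r + 21r²))`. -/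
theorem ssp333_amRadii_and_amRegion :
    amRadius !![(0 : ℝ), 0, 0; 1, 0, 0; 1 / 4, 1 / 4, 0] ![1 / 6, 1 / 6, 2 / 3] = 1 ∧
    amRadius !![(0 : ℝ), 0, 0; 14 / 15, 1 / 15, 0; 7 / 30, 1 / 5, 1 / 15]
      ![1 / 6, 1 / 6, 2 / 3] = (5 / 47) * (13 - 2 * Real.sqrt 7) ∧
    amRegion !![(0 : ℝ), 0, 0; 1, 0, 0; 1 / 4, 1 / 4, 0]
      !![(0 : ℝ), 0, 0; 14 / 15, 1 / 15, 0; 7 / 30, 1 / 5, 1 / 15]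
      ![1 / 6, 1 / 6, 2 / 3] ![1 / 6, 1 / 6, 2 / 3] =
    {p : ℝ × ℝ | 0 ≤ p.1 ∧ p.1 ≤ 1 ∧ 0 ≤ p.2 ∧
      p.2 ≤ (15 / 302) * (28 - 25 * p.1
              - Real.sqrt (180 - 192 * p.1 + 21 * p.1 ^ 2))} := by
  refine ⟨?_, ?_, ?_⟩
  · have hset : {r : ℝ | 0 ≤ r ∧ ∀ r' ∈ Icc (0 : ℝ) r,
        absMonoAt !![(0 : ℝ), 0, 0; 1, 0, 0; 1 / 4, 1 / 4, 0] ![1 / 6, 1 / 6, 2 / 3] r'} =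
        Icc 0 1 := by
      ext r
      refine and_congr_right fun hr => ⟨fun h => ?_, fun h r' hr' => ?_⟩
      · exact (absMonoAt_ssp333_explicit_iff hr).1 (h r ⟨hr, le_rfl⟩)
      · exact (absMonoAt_ssp333_explicit_iff hr'.1).2 (hr'.2.trans h)
    rw [amRadius, hset, csSup_Icc zero_le_one]
  · have hset : {r : ℝ | 0 ≤ r ∧ ∀ r' ∈ Icc (0 : ℝ) r,
        absMonoAt !![(0 : ℝ), 0, 0; 14 / 15, 1 / 15, 0; 7 / 30, 1 / 5, 1 / 15]
          ![1 / 6, 1 / 6, 2 / 3] r'} = Icc 0 ((5 / 47) * (13 - 2 * √7)) := by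
      ext t
      refine and_congr_right fun ht => ⟨fun h => ?_, fun h t' ht' => ?_⟩
      · exact ssp333_implicit_conditions_iff.1
          ((absMonoAt_ssp333_implicit_iff ht).1 (h t ⟨ht, le_rfl⟩))
      · exact (absMonoAt_ssp333_implicit_iff ht'.1).2
          (ssp333_implicit_conditions_iff.2 (ht'.2.trans h))
    have h7 : √7 < 3 := (Real.sqrt_lt' (by norm_num)).2 (by norm_num)
    rw [amRadius, hset, csSup_Icc (by linarith)]
  · ext ⟨r, t⟩
    simp only [amRegion, mem_ofPred_eq]
    constructor
    · rintro ⟨hr, ht, h⟩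
      have := (ssp333_pair_conditions_iff ht).1
        ((absMonoPairAt_ssp333_iff hr ht).1 (h r ⟨hr, le_rfl⟩ t ⟨ht, le_rfl⟩))
      exact ⟨hr, this.1, ht, this.2⟩
    · rintro ⟨hr, hr1, ht, h⟩
      refine ⟨hr, ht, fun r' hr' t' ht' => (absMonoPairAt_ssp333_iff hr'.1 ht'.1).2 ?_⟩
      obtain ⟨h₁, h₂⟩ := (ssp333_pair_conditions_iff ht).2 ⟨hr1, h⟩
      obtain ⟨hr'0, hr'r⟩ := hr'
      obtain ⟨ht'0, ht't⟩ := ht'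
      refine ⟨by linarith, h₂.trans ?_⟩
      have hdecr : 0 ≤ (r - r') * (450 - 225 * (r + r') - 375 * t) :=
        mul_nonneg (by linarith) (by linarith)
      have hdect : 0 ≤ (t - t') * (420 - 375 * r' - 151 * (t + t')) :=
        mul_nonneg (by linarith) (by linarith)
      linarith
end
end

section
/- For γ ∈ [0, 1/2], the radius of absolute monotonicity of the 2-stage implicit scheme Ã(γ) = [[γ,0],[1−2γ,γ]] with weights b̃ = (1/2,1/2) is given by: ℛ(Ã(γ)) = 1/(1 − 3γ) for 0 ≤ γ ≤ 1/4; ℛ(Ã(γ)) = (1 − 2γ)/(2γ² − 4γ + 1) − √((4γ − 1)/(2γ² − 4γ + 1)²) for 1/4 < γ < 1 − 1/√2; ℛ(Ã(γ)) = 1 + √2 for γ = 1 − 1/√2; and ℛ(Ã(γ)) = (1 − 2γ)/(2γ² − 4γ + 1) + √((4γ − 1)/(2γ² − 4γ + 1)²) for 1 − 1/√2 < γ ≤ 1/2. -/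
open Matrix Set

noncomputable section

/-- The explicit inverse of `1 + r • K` for the scheme `Ã(γ)`. -/
def gammaInv (γ r : ℝ) : Matrix (Fin 3) (Fin 3) ℝ :=
  !![1 / (1 + r * γ), 0, 0;
    -(r * (1 - 2 * γ)) / (1 + r * γ) ^ 2, 1 / (1 + r * γ), 0;
    -r / (2 * (1 + r * γ)) + r ^ 2 * (1 - 2 * γ) / (2 * (1 + r * γ) ^ 2),
      -r / (2 * (1 + r * γ)), 1]

theorem rkAugment_gamma (γ : ℝ) :
    rkAugment !![γ, 0; 1 - 2 * γ, γ] ![1 / 2, 1 / 2] =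
      !![γ, 0, 0; 1 - 2 * γ, γ, 0; 1 / 2, 1 / 2, 0] := by
  ext i j
  fin_cases i <;> fin_cases j <;> simp [rkAugment]

theorem gammaInv_mul (γ r : ℝ) (hd : 1 + r * γ ≠ 0) :
    gammaInv γ r * (1 + r • !![γ, 0, 0; 1 - 2 * γ, γ, 0; 1 / 2, 1 / 2, 0]) = 1 := by
  ext i j
  fin_cases i <;> fin_cases j <;>
    simp [gammaInv, Matrix.mul_apply, Fin.sum_univ_three] <;> field_simp <;> ring

theorem gammaInv_mul_augment (γ r : ℝ) (hd : 1 + r * γ ≠ 0) :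
    gammaInv γ r * !![γ, 0, 0; 1 - 2 * γ, γ, 0; 1 / 2, 1 / 2, 0] =
      !![γ / (1 + r * γ), 0, 0;
        (1 - 2 * γ) / (1 + r * γ) ^ 2, γ / (1 + r * γ), 0;
        (1 - r * (1 - 3 * γ)) / (2 * (1 + r * γ) ^ 2), 1 / (2 * (1 + r * γ)), 0] := by
  ext i j
  fin_cases i <;> fin_cases j <;>
    simp [gammaInv, Matrix.mul_apply, Fin.sum_univ_three] <;> field_simp <;> ring

theorem gammaInv_mulVec_one (γ r : ℝ) (hd : 1 + r * γ ≠ 0) :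
    (gammaInv γ r).mulVec (fun _ => 1) =
      ![1 / (1 + r * γ), (1 - r * (1 - 3 * γ)) / (1 + r * γ) ^ 2,
        (2 - 2 * (1 - 2 * γ) * r + (2 * γ ^ 2 - 4 * γ + 1) * r ^ 2)
          / (2 * (1 + r * γ) ^ 2)] := by
  ext i
  fin_cases i <;>
    simp [gammaInv, Matrix.mulVec, dotProduct, Fin.sum_univ_three] <;> field_simp <;> ring

/-- Absolute monotonicity of `Ã(γ)` at `-r` amounts to one linear and one quadratic inequality. -/
theorem absMonoAt_gamma_iff {γ r : ℝ} (hγ : γ ∈ Icc (0 : ℝ) (1 / 2)) (hr : 0 ≤ r) :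
    absMonoAt !![γ, 0; 1 - 2 * γ, γ] ![1 / 2, 1 / 2] r ↔
      r * (1 - 3 * γ) ≤ 1 ∧
        0 ≤ 2 - 2 * (1 - 2 * γ) * r + (2 * γ ^ 2 - 4 * γ + 1) * r ^ 2 := by
  obtain ⟨h0, h1⟩ := hγ
  have hd : 0 < 1 + r * γ := by positivity
  have hleft := gammaInv_mul γ r hd.ne'
  have hinv := Matrix.inv_eq_left_inv hleft
  have hunit := IsUnit.of_mul_eq_one_right _ hleft
  simp only [absMonoAt, rkAugment_gamma]
  rw [hinv, gammaInv_mul_augment γ r hd.ne', gammaInv_mulVec_one γ r hd.ne']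
  have hc : 0 ≤ 1 - 2 * γ := by linarith
  constructor
  · rintro ⟨-, h, h'⟩
    have hlin := h 2 0
    have hquad := h' 2
    simp only [Matrix.of_apply, Matrix.cons_val] at hlin hquad
    rw [le_div_iff₀ (by positivity), zero_mul] at hlin hquad
    exact ⟨by linarith, hquad⟩
  · rintro ⟨hlin, hquad⟩
    have hlin' : 0 ≤ 1 - r * (1 - 3 * γ) := by linarith
    refine ⟨hunit, fun i j => ?_, fun i => ?_⟩
    · fin_cases i <;> fin_cases j <;> simp <;> positivity
    · fin_cases i <;> simp <;> positivity

/-- A bound that is attained and beyond which absolute monotonicity fails is the radius. -/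
theorem amRadius_eq_of_forall {s : ℕ} {A : Matrix (Fin s) (Fin s) ℝ} {b : Fin s → ℝ} {R : ℝ}
    (hR : 0 ≤ R) (hle : ∀ r, 0 ≤ r → r ≤ R → absMonoAt A b r)
    (hgt : ∀ r, R < r → ∃ r', 0 ≤ r' ∧ r' ≤ r ∧ ¬ absMonoAt A b r') :
    amRadius A b = R := by
  refine IsGreatest.csSup_eq ⟨⟨hR, fun r hr => hle r hr.1 hr.2⟩, fun r hr => ?_⟩
  by_contra! hlt
  obtain ⟨r', h0, h1, hn⟩ := hgt r hlt
  exact hn (hr.2 r' ⟨h0, h1⟩)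

theorem amRadius_gamma_of_le {γ : ℝ} (h0 : 0 ≤ γ) (h : γ ≤ 1 / 4) :
    amRadius !![γ, 0; 1 - 2 * γ, γ] ![1 / 2, 1 / 2] = 1 / (1 - 3 * γ) := by
  have hγ : γ ∈ Icc (0 : ℝ) (1 / 2) := ⟨h0, by linarith⟩
  have hpos : 0 < 1 - 3 * γ := by linarith
  refine amRadius_eq_of_forall (by positivity) (fun r hr hrR => ?_) (fun r hr => ?_)
  · rw [absMonoAt_gamma_iff hγ hr]
    refine ⟨(le_div_iff₀ hpos).1 hrR, ?_⟩
    nlinarith [sq_nonneg (2 - (1 - 2 * γ) * r),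
      mul_nonneg (by linarith : 0 ≤ 1 - 4 * γ) (sq_nonneg r)]
  · have hr0 : 0 ≤ r := (one_div_pos.2 hpos).le.trans hr.le
    refine ⟨r, hr0, le_rfl, fun hmono => ?_⟩
    exact absurd ((absMonoAt_gamma_iff hγ hr0).1 hmono).1 (not_le.2 ((div_lt_iff₀ hpos).1 hr))

/-- For `γ > 1 / 4` the radius is the smallest positive root of the quadratic condition, in a
form that stays valid when the leading coefficient vanishes. -/
theorem amRadius_gamma_of_gt {γ : ℝ} (h : 1 / 4 < γ) (h1 : γ ≤ 1 / 2) :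
    amRadius !![γ, 0; 1 - 2 * γ, γ] ![1 / 2, 1 / 2] =
      2 / (1 - 2 * γ + Real.sqrt (4 * γ - 1)) := by
  have hγ : γ ∈ Icc (0 : ℝ) (1 / 2) := ⟨by linarith, h1⟩
  have hs : 0 < Real.sqrt (4 * γ - 1) := Real.sqrt_pos.2 (by linarith)
  have hs2 : Real.sqrt (4 * γ - 1) ^ 2 = 4 * γ - 1 := Real.sq_sqrt (by linarith)
  set s := Real.sqrt (4 * γ - 1)
  have hc : 0 ≤ 1 - 2 * γ := by linarith
  have hfactor (r : ℝ) : 2 - 2 * (1 - 2 * γ) * r + (2 * γ ^ 2 - 4 * γ + 1) * r ^ 2 =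
      (2 - r * (1 - 2 * γ + s)) * (2 - r * (1 - 2 * γ - s)) / 2 := by
    linear_combination (r ^ 2 / 2) * hs2
  have hcs : 0 < 1 - 2 * γ + s := by linarith
  refine amRadius_eq_of_forall (by positivity) (fun r hr hrR => ?_) (fun r hr => ?_)
  · rw [absMonoAt_gamma_iff hγ hr, hfactor]
    have hroot := (le_div_iff₀ hcs).1 hrR
    have hother : r * (1 - 2 * γ - s) ≤ r * (1 - 2 * γ + s) := by gcongr; linarith
    refine ⟨?_, ?_⟩
    · have : r * (2 - 6 * γ) ≤ r * (1 - 2 * γ + s) := by gcongr; linarith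
      linarith
    · exact div_nonneg (mul_nonneg (by linarith) (by linarith)) two_pos.le
  · have hr0 : 0 < r := (div_pos two_pos hcs).trans hr
    have hden : 0 < 2 * (1 - 2 * γ) + s := by linarith
    set t := min r (4 / (2 * (1 - 2 * γ) + s))
    have ht0 : 0 < t := lt_min hr0 (by positivity)
    refine ⟨t, ht0.le, min_le_left _ _, fun hmono => ?_⟩
    have hquad := ((absMonoAt_gamma_iff hγ ht0.le).1 hmono).2
    have hlo : 2 / (1 - 2 * γ + s) < t :=
      lt_min hr ((div_lt_div_iff₀ hcs hden).2 (by linarith))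
    have hlo' := (div_lt_iff₀ hcs).1 hlo
    have hhi := (le_div_iff₀ hden).1 (min_le_right r (4 / (2 * (1 - 2 * γ) + s)))
    have hhi' : t * (1 - 2 * γ - s) < 2 := by
      have := mul_pos ht0 hs
      change t * _ ≤ 4 at hhi
      linarith
    rw [hfactor] at hquad
    have := mul_neg_of_neg_of_pos (sub_neg.2 hlo') (sub_pos.2 hhi')
    linarith

theorem one_sub_one_div_sqrt_two : 1 - 1 / Real.sqrt 2 = 1 - Real.sqrt 2 / 2 := by
  rw [Real.sqrt_div_self']

/-- The radius of absolute monotonicity of the 2-stage implicit scheme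
`Ã(γ) = [[γ,0],[1−2γ,γ]]` with weights `b̃ = (1/2,1/2)`, as a function of
`γ ∈ [0, 1/2]`, is given by the stated piecewise formula. -/
theorem implicit_gamma_amRadius (γ : ℝ) (hγ : γ ∈ Icc (0 : ℝ) (1 / 2)) :
    (γ ≤ 1 / 4 →
      amRadius !![γ, 0; 1 - 2 * γ, γ] ![1 / 2, 1 / 2] = 1 / (1 - 3 * γ)) ∧
    (1 / 4 < γ → γ < 1 - 1 / Real.sqrt 2 →
      amRadius !![γ, 0; 1 - 2 * γ, γ] ![1 / 2, 1 / 2] =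
        (1 - 2 * γ) / (2 * γ ^ 2 - 4 * γ + 1)
          - Real.sqrt ((4 * γ - 1) / (2 * γ ^ 2 - 4 * γ + 1) ^ 2)) ∧
    (γ = 1 - 1 / Real.sqrt 2 →
      amRadius !![γ, 0; 1 - 2 * γ, γ] ![1 / 2, 1 / 2] = 1 + Real.sqrt 2) ∧
    (1 - 1 / Real.sqrt 2 < γ →
      amRadius !![γ, 0; 1 - 2 * γ, γ] ![1 / 2, 1 / 2] =
        (1 - 2 * γ) / (2 * γ ^ 2 - 4 * γ + 1)
          + Real.sqrt ((4 * γ - 1) / (2 * γ ^ 2 - 4 * γ + 1) ^ 2)) := by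
  obtain ⟨h0, h1⟩ := hγ
  rw [one_sub_one_div_sqrt_two]
  have hsq : Real.sqrt 2 ^ 2 = 2 := Real.sq_sqrt two_pos.le
  have hlo : 1.4 < Real.sqrt 2 := Real.lt_sqrt_of_sq_lt (by norm_num)
  have hhi : Real.sqrt 2 < 1.5 := (Real.sqrt_lt' (by norm_num)).2 (by norm_num)
  have hD : 2 * γ ^ 2 - 4 * γ + 1 =
      2 * (1 - Real.sqrt 2 / 2 - γ) * (1 + Real.sqrt 2 / 2 - γ) := by
    linear_combination (1 / 2) * hsq
  refine ⟨amRadius_gamma_of_le h0, fun h hlt => ?_, fun h => ?_, fun h => ?_⟩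
  · have hDpos : 0 < 2 * γ ^ 2 - 4 * γ + 1 := by
      rw [hD]
      exact mul_pos (by linarith) (by linarith)
    have hs : 0 < Real.sqrt (4 * γ - 1) := Real.sqrt_pos.2 (by linarith)
    have hs2 : Real.sqrt (4 * γ - 1) ^ 2 = 4 * γ - 1 := Real.sq_sqrt (by linarith)
    have hcs : 0 < 1 - 2 * γ + Real.sqrt (4 * γ - 1) := by linarith
    rw [amRadius_gamma_of_gt h h1, Real.sqrt_div' _ (sq_nonneg _), Real.sqrt_sq hDpos.le,
      ← sub_div, div_eq_div_iff hcs.ne' hDpos.ne']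
    linear_combination hs2
  · have hγ4 : 4 * γ - 1 = (Real.sqrt 2 - 1) ^ 2 := by
      linear_combination 4 * h - hsq
    rw [amRadius_gamma_of_gt (by linarith) h1, hγ4, Real.sqrt_sq (by linarith), h,
      div_eq_iff (by linarith)]
    linear_combination -2 * hsq
  · have hDneg : 2 * γ ^ 2 - 4 * γ + 1 < 0 := by
      rw [hD]
      exact mul_neg_of_neg_of_pos (by linarith) (by linarith)
    have hγ4 : 1 / 4 < γ := by linarith
    have hs : 0 < Real.sqrt (4 * γ - 1) := Real.sqrt_pos.2 (by linarith)
    have hs2 : Real.sqrt (4 * γ - 1) ^ 2 = 4 * γ - 1 := Real.sq_sqrt (by linarith)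
    have hcs : 0 < 1 - 2 * γ + Real.sqrt (4 * γ - 1) := by linarith
    rw [amRadius_gamma_of_gt hγ4 h1, Real.sqrt_div' _ (sq_nonneg _), Real.sqrt_sq_eq_abs,
      abs_of_neg hDneg, div_neg, ← sub_eq_add_neg, ← sub_div,
      div_eq_div_iff hcs.ne' hDneg.ne]
    linear_combination hs2
end
end

section
/- For γ ∈ [0, 1/2], consider the IMEX pair with explicit part A = [[0,0],[1,0]], b = (1/2,1/2), and implicit part Ã(γ) = [[γ,0],[1−2γ,γ]], b̃ = (1/2,1/2). Then the region of absolute monotonicity is: ℛ(A, Ã(γ)) = {(r, r̃) : 0 ≤ r ≤ 1 and 0 ≤ r̃ ≤ (1 − r)/(1 − γ)} for 0 ≤ γ ≤ 1/3, and ℛ(A, Ã(γ)) = {(r, r̃) : 0 ≤ r ≤ (1 − 2γ)/γ and 0 ≤ r̃ ≤ (1 − r)/(1 − γ)} for 1/3 ≤ γ ≤ 1/2. -/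
open Matrix Set

noncomputable section

/-- The augmented matrix of a two-stage scheme, written out entrywise. -/
theorem rkAugment_two_s7 (a₁₁ a₁₂ a₂₁ a₂₂ b₁ b₂ : ℝ) :
    rkAugment !![a₁₁, a₁₂; a₂₁, a₂₂] ![b₁, b₂] =
      !![a₁₁, a₁₂, 0; a₂₁, a₂₂, 0; b₁, b₂, 0] := by
  ext i j
  fin_cases i <;> fin_cases j <;> simp [rkAugment]

/-- A right inverse of the lower triangular matrix `I + rK + r̃K̃` of the IMEX pair. -/
theorem lowerTriangular_mul_inv (c d h : ℝ) (hd : d ≠ 0) :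
    !![d, 0, 0; c, d, 0; h, h, 1] *
      !![1 / d, 0, 0; -c / d ^ 2, 1 / d, 0; h * (c - d) / d ^ 2, -h / d, 1] = 1 := by
  ext i j
  fin_cases i <;> fin_cases j <;> simp [Matrix.mul_apply, Fin.sum_univ_three] <;>
    field_simp <;> ring

/-- At points with nonnegative `r` and `t`, absolute monotonicity of the IMEX pair reduces to
two linear inequalities. -/
theorem absMonoPairAt_imex_iff {γ r t : ℝ} (h0 : 0 ≤ γ) (h1 : γ ≤ 1 / 2) (hr : 0 ≤ r)
    (ht : 0 ≤ t) :
    absMonoPairAt !![(0 : ℝ), 0; 1, 0] !![γ, 0; 1 - 2 * γ, γ] ![1 / 2, 1 / 2] ![1 / 2, 1 / 2] r t ↔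
      r + t * (1 - γ) ≤ 1 ∧ r * γ ≤ 1 - 2 * γ := by
  obtain ⟨d, hd⟩ : ∃ d, d = 1 + t * γ := ⟨_, rfl⟩
  obtain ⟨c, hc⟩ : ∃ c, c = r + t * (1 - 2 * γ) := ⟨_, rfl⟩
  obtain ⟨h, hh⟩ : ∃ h, h = (r + t) / 2 := ⟨_, rfl⟩
  have hd0 : 0 < d := by rw [hd]; positivity
  have hc0 : 0 ≤ c := by rw [hc]; nlinarith
  have hh0 : 0 ≤ h := by rw [hh]; positivity
  have hM : (1 : Matrix (Fin 3) (Fin 3) ℝ) + r • !![0, 0, 0; 1, 0, 0; 1 / 2, 1 / 2, 0] +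
      t • !![γ, 0, 0; 1 - 2 * γ, γ, 0; 1 / 2, 1 / 2, 0] = !![d, 0, 0; c, d, 0; h, h, 1] := by
    ext i j
    fin_cases i <;> fin_cases j <;> simp [hd, hc, hh] <;> ring
  have hinv := lowerTriangular_mul_inv c d h hd0.ne'
  have hunit : IsUnit !![d, 0, 0; c, d, 0; h, h, 1] :=
    (Matrix.isUnit_iff_isUnit_det _).2 (Matrix.isUnit_det_of_right_inverse hinv)
  have hweight : r + t * (1 - γ) ≤ 1 ↔ h ≤ d / 2 := by
    rw [hd, hh]; constructor <;> intro <;> linarith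
  have hstage : r * γ ≤ 1 - 2 * γ ↔ c * γ ≤ (1 - 2 * γ) * d := by
    rw [hd, hc]; constructor <;> intro <;> linarith
  have hcd : r + t * (1 - γ) ≤ 1 → c ≤ d := by
    intro; rw [hd, hc]; nlinarith [mul_nonneg ht h0]
  simp only [absMonoPairAt, rkAugment_two_s7, hM, Matrix.inv_eq_right_inv hinv, hunit, true_and]
  constructor
  · rintro ⟨hK, hKt, -⟩
    have hK20 := hK 2 0
    have hKt10 := hKt 1 0
    simp only [Matrix.mul_apply, Fin.sum_univ_three] at hK20 hKt10
    simp at hK20 hKt10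
    field_simp at hK20 hKt10
    rw [hweight, hstage]
    constructor <;> linarith
  · rintro ⟨hw, hs⟩
    have hcd := hcd hw
    rw [hweight] at hw
    rw [hstage] at hs
    have hγ : 0 ≤ 1 - 2 * γ := by linarith
    have hhc := mul_nonneg hh0 hc0
    have hhcγ := mul_nonneg hhc h0
    have hhdγ := mul_nonneg (mul_nonneg hh0 hd0.le) h0
    have hdw := mul_nonneg hd0.le (sub_nonneg.2 hw)
    have hhγ := mul_nonneg hh0 hγ
    refine ⟨fun i j => ?_, fun i j => ?_, fun i => ?_⟩
    · fin_cases i <;> fin_cases j <;> simp [Matrix.mul_apply, Fin.sum_univ_three] <;>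
        field_simp <;> linarith
    · fin_cases i <;> fin_cases j <;> simp [Matrix.mul_apply, Fin.sum_univ_three] <;>
        field_simp <;> linarith
    · fin_cases i <;> simp [Matrix.mulVec, dotProduct, Fin.sum_univ_three] <;>
        field_simp <;> linarith

/-- The region of absolute monotonicity of the IMEX pair, cut out by linear inequalities. -/
theorem mem_amRegion_imex_iff {γ : ℝ} (h0 : 0 ≤ γ) (h1 : γ ≤ 1 / 2) (p : ℝ × ℝ) :
    p ∈ amRegion !![(0 : ℝ), 0; 1, 0] !![γ, 0; 1 - 2 * γ, γ] ![1 / 2, 1 / 2] ![1 / 2, 1 / 2] ↔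
      0 ≤ p.1 ∧ 0 ≤ p.2 ∧ p.1 + p.2 * (1 - γ) ≤ 1 ∧ p.1 * γ ≤ 1 - 2 * γ := by
  refine and_congr_right fun hr => and_congr_right fun ht => ⟨fun H => ?_, fun H r hr' t ht' => ?_⟩
  · exact (absMonoPairAt_imex_iff h0 h1 hr ht).1 (H _ ⟨hr, le_rfl⟩ _ ⟨ht, le_rfl⟩)
  · have hγ : 0 ≤ 1 - γ := by linarith
    refine (absMonoPairAt_imex_iff h0 h1 hr'.1 ht'.1).2 ⟨?_, ?_⟩
    · linarith [mul_le_mul_of_nonneg_right ht'.2 hγ, hr'.2]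
    · linarith [mul_le_mul_of_nonneg_right hr'.2 h0]

/-- For `γ ∈ [0, 1/2]`, the region of absolute monotonicity of the IMEX pair with
explicit part `A = [[0,0],[1,0]]`, `b = (1/2,1/2)` and implicit part
`Ã(γ) = [[γ,0],[1−2γ,γ]]`, `b̃ = (1/2,1/2)` is given by the stated piecewise formula. -/
theorem imex_gamma_amRegion (γ : ℝ) (hγ : γ ∈ Icc (0 : ℝ) (1 / 2)) :
    (γ ≤ 1 / 3 →
      amRegion !![(0 : ℝ), 0; 1, 0] !![γ, 0; 1 - 2 * γ, γ]
          ![1 / 2, 1 / 2] ![1 / 2, 1 / 2] =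
        {p : ℝ × ℝ | 0 ≤ p.1 ∧ p.1 ≤ 1 ∧ 0 ≤ p.2 ∧ p.2 ≤ (1 - p.1) / (1 - γ)}) ∧
    (1 / 3 ≤ γ →
      amRegion !![(0 : ℝ), 0; 1, 0] !![γ, 0; 1 - 2 * γ, γ]
          ![1 / 2, 1 / 2] ![1 / 2, 1 / 2] =
        {p : ℝ × ℝ | 0 ≤ p.1 ∧ p.1 ≤ (1 - 2 * γ) / γ ∧ 0 ≤ p.2 ∧
          p.2 ≤ (1 - p.1) / (1 - γ)}) := by
  obtain ⟨h0, h1⟩ := hγ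
  have hγ1 : 0 < 1 - γ := by linarith
  constructor <;> intro hγ3 <;> ext p <;>
    rw [mem_amRegion_imex_iff h0 h1, mem_ofPred_eq, le_div_iff₀ hγ1]
  · constructor
    · rintro ⟨hr, ht, hw, -⟩
      have := mul_nonneg ht hγ1.le
      exact ⟨hr, by linarith, ht, by linarith⟩
    · rintro ⟨hr, hr1, ht, hw⟩
      exact ⟨hr, ht, by linarith, by nlinarith⟩
  · rw [le_div_iff₀ (by linarith : 0 < γ)]
    constructor
    · rintro ⟨hr, ht, hw, hs⟩
      exact ⟨hr, hs, ht, by linarith⟩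
    · rintro ⟨hr, hs, ht, hw⟩
      exact ⟨hr, ht, by linarith, hs⟩
end
end

section
/- The real cubic equation 1 + x + x²/2 + x³/12 = −1 has a real root x₀ in the open interval (−4.52, −4.51), and |1 + x + x²/2 + x³/12| < 1 for all real x with x₀ < x < 0. -/
open Set

/-- The stability function of SSPRK(3,2) is an affine function of `(1 + x / 2) ^ 3`. -/
theorem ssprk32_stability_function_eq (x : ℝ) :
    1 + x + x ^ 2 / 2 + x ^ 3 / 12 = 1 / 3 + 2 / 3 * (1 + x / 2) ^ 3 := by
  ring

theorem strictMono_ssprk32_stability_function :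
    StrictMono fun x : ℝ => 1 + x + x ^ 2 / 2 + x ^ 3 / 12 := by
  intro x y hxy
  have hcube : (1 + x / 2) ^ 3 < (1 + y / 2) ^ 3 :=
    (Odd.strictMono_pow (by decide)) (by linarith)
  simp only [ssprk32_stability_function_eq]
  linarith

/-- The equation `1 + x + x²/2 + x³/12 = −1` (i.e. `R(x) = −1` for the stability
function of SSPRK(3,2)) has a real root `x₀ ∈ (−4.52, −4.51)`, and
`|1 + x + x²/2 + x³/12| < 1` for all `x₀ < x < 0`; thus the stability region of
SSPRK(3,2) meets the negative real half-line at `x ≈ −4.519`. -/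
theorem ssprk32_stability_interval :
    ∃ x₀ ∈ Ioo (-4.52 : ℝ) (-4.51),
      1 + x₀ + x₀ ^ 2 / 2 + x₀ ^ 3 / 12 = -1 ∧
      ∀ x : ℝ, x₀ < x → x < 0 → |1 + x + x ^ 2 / 2 + x ^ 3 / 12| < 1 := by
  have hcont : ContinuousOn (fun x : ℝ => 1 + x + x ^ 2 / 2 + x ^ 3 / 12)
      (Icc (-4.52) (-4.51)) := by fun_prop
  obtain ⟨x₀, hmem, hroot⟩ := intermediate_value_Ioo (by norm_num) hcont
    (show (-1 : ℝ) ∈ Ioo _ _ by constructor <;> norm_num)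
  refine ⟨x₀, hmem, hroot, fun x hx hx0 => abs_lt.2 ⟨?_, ?_⟩⟩
  · exact hroot ▸ strictMono_ssprk32_stability_function hx
  · simpa using strictMono_ssprk32_stability_function hx0
end
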